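/- arXiv:1904.06911 — 2 statements merged into one kernel-verified Lean document; each statement's English description precedes it below -/
import Mathlib

section
/- Let Q be the quadrilateral with vertices (0, 1), (0, 5/6), (−1/4, 3/4) and (−1/3, 5/6). Then: (a) every centrally symmetric convex decagon centered at the origin whose set of edge midpoints is D₁ has at least one vertex lying in the interior of Q; and (b) for every point v in the interior of Q there exists a centrally symmetric convex decagon centered at the origin whose set of edge midpoints is D₁ and which has v as one of its vertices. -/
open Set Pointwise

noncomputable section

/-- A point of the plane `ℝ²`. -/
abbrev Pt : Type := ℝ × ℝ

/-- The standard integer lattice `ℤ² ⊆ ℝ²`. -/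
def IntLattice : Set Pt := {p : Pt | ∃ a b : ℤ, p = ((a : ℝ), (b : ℝ))}

/-- A lattice in `ℝ²` is the image of `ℤ²` under an invertible linear map. -/
def IsLattice (L : Set Pt) : Prop :=
  ∃ B : Pt ≃ₗ[ℝ] Pt, L = B '' IntLattice

/-- `K + L` is a `k`-fold lattice tiling of the plane: `L` is a lattice, every point lies in
at least `k` translates `K + l` (`l ∈ L`), and every point lies in at most `k` translates
`interior K + l`. -/
def IsKFoldLatticeTiling (K L : Set Pt) (k : ℕ) : Prop :=
  IsLattice L ∧
  (∀ p : Pt, (k : ℕ∞) ≤ {l ∈ L | p - l ∈ K}.encard) ∧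
  (∀ p : Pt, {l ∈ L | p - l ∈ interior K}.encard ≤ (k : ℕ∞))

/-- A discrete multiset of points of the plane, given as a family `x : I → ℝ²`:
every bounded set contains `x i` for only finitely many indices. -/
def IsDiscreteFamily {I : Type} (x : I → Pt) : Prop :=
  ∀ B : Set Pt, Bornology.IsBounded B → {i : I | x i ∈ B}.Finite

/-- `K + X` is a `k`-fold translative tiling of the plane, for the discrete multiset
`X = (x i)_{i ∈ I}`: every point lies in `K + x i` for at least `k` indices, and in
`interior K + x i` for at most `k` indices. -/
def IsKFoldTranslativeTiling {I : Type} (K : Set Pt) (x : I → Pt) (k : ℕ) : Prop :=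
  IsDiscreteFamily x ∧
  (∀ p : Pt, (k : ℕ∞) ≤ {i : I | p - x i ∈ K}.encard) ∧
  (∀ p : Pt, {i : I | p - x i ∈ interior K}.encard ≤ (k : ℕ∞))

/-- A convex polygon with exactly `n` vertices: a compact convex set with nonempty interior
which is the convex hull of its finitely many (`n`) extreme points. -/
def IsConvexPolygon (P : Set Pt) (n : ℕ) : Prop :=
  Convex ℝ P ∧ IsCompact P ∧ (interior P).Nonempty ∧
  (Set.extremePoints ℝ P).Finite ∧ (Set.extremePoints ℝ P).ncard = n ∧
  P = convexHull ℝ (Set.extremePoints ℝ P)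

/-- `[a, b]` is an edge of the polygon `P`: a nondegenerate segment which is an extreme
(face) subset of `P`. -/
def IsEdgeOf (P : Set Pt) (a b : Pt) : Prop :=
  a ≠ b ∧ IsExtreme ℝ P (segment ℝ a b)

/-- The set of midpoints of the edges of `P`. -/
def edgeMidpoints (P : Set Pt) : Set Pt :=
  {u : Pt | ∃ a b : Pt, IsEdgeOf P a b ∧ u = midpoint ℝ a b}

/-- `P` is centrally symmetric (about some center `c`). -/
def CentrallySymmetric (P : Set Pt) : Prop :=
  ∃ c : Pt, ∀ x : Pt, x ∈ P ↔ c + c - x ∈ P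

/-- `D` is a parallelogram. -/
def IsParallelogram (D : Set Pt) : Prop :=
  ∃ v a b : Pt, LinearIndependent ℝ ![a, b] ∧
    D = convexHull ℝ ({v, v + a, v + b, v + a + b} : Set Pt)

/-- The octagon `P₈(α)`, with vertices `±(α−1, 2), ±(α, −2), ±(1−α, 0), ±(1+α, −1)`. -/
def P8 (α : ℝ) : Set Pt :=
  convexHull ℝ ({(α - 1, 2), (α, -2), (1 - α, 0), (1 + α, -1),
                 (1 - α, -2), (-α, 2), (α - 1, 0), (-(1 + α), 1)} : Set Pt)

/-- The ten points `D₁`. -/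
def D1 : Set Pt :=
  {(-1, 1/2), (1/2, 1), (3/2, 1), (2, 1/2), (2, 0),
   (1, -1/2), (-1/2, -1), (-3/2, -1), (-2, -1/2), (-2, 0)}

/-- The ten points `D₂`. -/
def D2 : Set Pt :=
  {(1/2, -1), (3/2, -1/2), (2, 0), (3/2, 1/2), (1/2, 1),
   (-1/2, 1), (-3/2, 1/2), (-2, 0), (-3/2, -1/2), (-1/2, -1)}

/-- The set `(1/2)Λ = {λ/2 : λ ∈ Λ}`. -/
def halfSet (L : Set Pt) : Set Pt := (fun l : Pt => (2⁻¹ : ℝ) • l) '' L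

/-- A cyclic enumeration `v : ZMod n → ℝ²` of the vertices of a convex polygon `P` with `n`
vertices: `v` is injective, its range is the vertex set of `P`, and consecutive vertices are
joined by edges of `P`. -/
def IsCyclicVertexEnum (P : Set Pt) (n : ℕ) (v : ZMod n → Pt) : Prop :=
  Function.Injective v ∧ Set.range v = Set.extremePoints ℝ P ∧
  ∀ i : ZMod n, IsEdgeOf P (v i) (v (i + 1))

/-- The quadrilateral `Q` of Theorem 2. -/
def Qquad : Set Pt :=
  convexHull ℝ ({(0, 1), (0, 5/6), (-1/4, 3/4), (-1/3, 5/6)} : Set Pt)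


/-- Orientation of the triangle `a b p`. -/
def orient (a b p : Pt) : ℝ :=
  (b.1 - a.1) * (p.2 - a.2) - (b.2 - a.2) * (p.1 - a.1)

lemma orient_comb (a b p q : Pt) (s t : ℝ) (h : s + t = 1) :
    orient a b (s • p + t • q) = s * orient a b p + t * orient a b q := by
  obtain rfl : t = 1 - s := by linarith
  simp only [orient, Prod.fst_add, Prod.snd_add, Prod.smul_fst, Prod.smul_snd, smul_eq_mul]
  ring

lemma orient_of_mem_segment {a b p : Pt} (h : p ∈ segment ℝ a b) : orient a b p = 0 := by
  obtain ⟨s, t, _, _, hst, rfl⟩ := h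
  rw [orient_comb _ _ _ _ _ _ hst]
  simp only [orient]
  ring

lemma exists_param {a b p : Pt} (hab : a ≠ b) (h : orient a b p = 0) :
    ∃ s : ℝ, p = (1 - s) • a + s • b := by
  simp only [orient] at h
  by_cases h1 : b.1 - a.1 = 0
  · have h2 : b.2 - a.2 ≠ 0 := by
      intro h2
      exact hab (Prod.ext (by linarith) (by linarith))
    refine ⟨(p.2 - a.2) / (b.2 - a.2), ?_⟩
    rw [h1] at h
    have h3 : p.1 - a.1 = 0 := by
      have : (b.2 - a.2) * (p.1 - a.1) = 0 := by linarith
      exact (mul_eq_zero.mp this).resolve_left h2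
    ext
    · simp only [Prod.fst_add, Prod.smul_fst, smul_eq_mul]
      have : b.1 = a.1 := by linarith
      rw [this]; linarith
    · simp only [Prod.snd_add, Prod.smul_snd, smul_eq_mul]
      field_simp
      ring
  · refine ⟨(p.1 - a.1) / (b.1 - a.1), ?_⟩
    ext
    · simp only [Prod.fst_add, Prod.smul_fst, smul_eq_mul]
      field_simp
      ring
    · simp only [Prod.snd_add, Prod.smul_snd, smul_eq_mul]
      field_simp
      linarith

lemma mem_segment_of_orient {P : Set Pt} {a b p : Pt} (h : IsEdgeOf P a b) (hp : p ∈ P)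
    (h0 : orient a b p = 0) : p ∈ segment ℝ a b := by
  obtain ⟨hab, hE⟩ := h
  obtain ⟨s, hs⟩ := exists_param hab h0
  have ha : a ∈ segment ℝ a b := left_mem_segment ℝ a b
  have hb : b ∈ segment ℝ a b := right_mem_segment ℝ a b
  rcases lt_or_ge s 0 with h1 | h1
  · refine hE.left_mem_of_mem_openSegment hp (hE.subset hb) ha ⟨1 / (1 - s), -s / (1 - s), ?_, ?_, ?_, ?_⟩
    · apply div_pos <;> linarith
    · apply div_pos <;> linarith
    · have : 1 - s ≠ 0 := by linarith
      field_simp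
      ring
    · have : 1 - s ≠ 0 := by linarith
      rw [hs]
      ext <;> simp <;> field_simp <;> ring
  rcases le_or_gt s 1 with h2 | h2
  · exact ⟨1 - s, s, by linarith, h1, by ring, hs.symm⟩
  · refine hE.left_mem_of_mem_openSegment hp (hE.subset ha) hb ⟨1 / s, (s - 1) / s, ?_, ?_, ?_, ?_⟩
    · apply div_pos <;> linarith
    · apply div_pos <;> linarith
    · have : s ≠ 0 := by linarith
      field_simp
      ring
    · have : s ≠ 0 := by linarith
      rw [hs]
      ext <;> simp <;> field_simp <;> ring

/-- All of `P` lies on one side of an edge. -/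
lemma edge_side {P : Set Pt} (hP : Convex ℝ P) {a b c d : Pt} (h : IsEdgeOf P a b) (hc : c ∈ P)
    (hd : d ∈ P) (h1 : 0 < orient a b c) (h2 : orient a b d < 0) : False := by
  set C := orient a b c with hC
  set D := orient a b d with hD
  have hpos : 0 < C - D := by linarith
  have hs : 0 < -D / (C - D) := div_pos (by linarith) hpos
  have ht : 0 < C / (C - D) := div_pos (by linarith) hpos
  have hst : -D / (C - D) + C / (C - D) = 1 := by field_simp; ring
  set q : Pt := (-D / (C - D)) • c + (C / (C - D)) • d with hq
  have hqP : q ∈ P := hP hc hd hs.le ht.le hst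
  have hq0 : orient a b q = 0 := by
    rw [hq, orient_comb _ _ _ _ _ _ hst, ← hC, ← hD]
    field_simp
    ring
  have hqs := mem_segment_of_orient h hqP hq0
  have hcs := h.2.left_mem_of_mem_openSegment hc hd hqs ⟨_, _, hs, ht, hst, rfl⟩
  have := orient_of_mem_segment hcs
  linarith

lemma left_mem_extreme {P : Set Pt} {a b : Pt} (h : IsEdgeOf P a b) :
    a ∈ Set.extremePoints ℝ P := by
  apply h.2.extremePoints_subset_extremePoints
  refine ⟨left_mem_segment ℝ a b, ?_⟩
  rintro x ⟨s, t, hs, ht, hst, rfl⟩ y ⟨s', t', hs', ht', hst', rfl⟩ ⟨u, v, hu, hv, huv, hE⟩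
  have key : (u * t + v * t') • (b - a) = 0 := by
    have h1 : s = 1 - t := by linarith
    have h2 : s' = 1 - t' := by linarith
    have h3 : v = 1 - u := by linarith
    subst h1 h2 h3
    have : u • ((1 - t) • a + t • b) + (1 - u) • ((1 - t') • a + t' • b) - a
        = (u * t + (1 - u) * t') • (b - a) := by module
    rw [← this, hE, sub_self]
  have hz : u * t + v * t' = 0 := by
    rcases smul_eq_zero.mp key with h' | h'
    · exact h'
    · exact absurd (sub_eq_zero.mp h').symm h.1
  have ht0 : t = 0 := by
    have h1 : 0 ≤ u * t := by positivity
    have h2 : 0 ≤ v * t' := by positivity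
    have : u * t = 0 := by linarith
    exact (mul_eq_zero.mp this).resolve_left hu.ne'
  subst ht0
  have : s = 1 := by linarith
  simp [this]

lemma IsEdgeOf.symm' {P : Set Pt} {a b : Pt} (h : IsEdgeOf P a b) : IsEdgeOf P b a :=
  ⟨h.1.symm, by rw [segment_symm]; exact h.2⟩

lemma right_mem_extreme {P : Set Pt} {a b : Pt} (h : IsEdgeOf P a b) :
    b ∈ Set.extremePoints ℝ P := left_mem_extreme h.symm'

/-- An extreme point lying on an edge is one of its endpoints. -/
lemma eq_or_eq_of_extreme {P : Set Pt} {a b p : Pt} (h : IsEdgeOf P a b)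
    (hp : p ∈ Set.extremePoints ℝ P) (hs : p ∈ segment ℝ a b) : p = a ∨ p = b := by
  have ha := h.2.subset (left_mem_segment ℝ a b)
  have hb := h.2.subset (right_mem_segment ℝ a b)
  by_contra hne
  push Not at hne
  have := mem_openSegment_of_ne_left_right (Ne.symm hne.1) (Ne.symm hne.2) hs
  exact hne.1 (hp.2 ha hb this).symm

lemma interior_halfplane {S : Set Pt} {p : Pt} (α β c : ℝ) (hne : α ≠ 0 ∨ β ≠ 0)
    (hS : ∀ q ∈ S, α * q.1 + β * q.2 ≤ c) (hp : p ∈ interior S) : α * p.1 + β * p.2 < c := by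
  have hcont : Filter.Tendsto (fun t : ℝ => ((p.1 + t * α, p.2 + t * β) : Pt)) (nhds 0) (nhds p) := by
    have : Continuous (fun t : ℝ => ((p.1 + t * α, p.2 + t * β) : Pt)) := by fun_prop
    simpa using this.tendsto 0
  have hev := hcont (mem_interior_iff_mem_nhds.mp hp)
  obtain ⟨ε, hε, hb⟩ := Metric.mem_nhds_iff.mp hev
  have hmem : ε / 2 ∈ Metric.ball (0 : ℝ) ε := by
    simp [abs_of_pos hε]
    linarith
  have h1 := hS _ (hb hmem)
  simp only at h1
  have h2 : 0 < α ^ 2 + β ^ 2 := by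
    rcases hne with h | h
    · have := sq_nonneg β; positivity
    · have := sq_nonneg α; positivity
  nlinarith [mul_pos (half_pos hε) h2]

lemma Q_strict {p : Pt} (hp : p ∈ interior Qquad) :
    p.1 < 0 ∧ 1 / 2 < p.1 + p.2 ∧ 2 * p.2 - p.1 < 2 ∧ 5 < 6 * p.2 - 2 * p.1 := by
  have key : ∀ α β c : ℝ, (α ≠ 0 ∨ β ≠ 0) → α * 0 + β * 1 ≤ c → α * 0 + β * (5/6) ≤ c →
      α * (-1/4) + β * (3/4) ≤ c → α * (-1/3) + β * (5/6) ≤ c → α * p.1 + β * p.2 < c := by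
    intro α β c hne h1 h2 h3 h4
    refine interior_halfplane α β c hne ?_ hp
    have hconv : Convex ℝ {q : Pt | α * q.1 + β * q.2 ≤ c} := by
      rintro x hx y hy s t hs ht hst
      simp only [mem_ofPred_eq, Prod.fst_add, Prod.snd_add, Prod.smul_fst, Prod.smul_snd,
        smul_eq_mul] at *
      obtain rfl : t = 1 - s := by linarith
      nlinarith [mul_le_mul_of_nonneg_left hx hs, mul_le_mul_of_nonneg_left hy ht]
    have hsub : ({(0, 1), (0, 5/6), (-1/4, 3/4), (-1/3, 5/6)} : Set Pt) ⊆
        {q : Pt | α * q.1 + β * q.2 ≤ c} := by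
      rintro q (rfl | rfl | rfl | rfl) <;> assumption
    exact fun q hq => convexHull_min hsub hconv hq
  refine ⟨?_, ?_, ?_, ?_⟩
  · have := key 1 0 0 (by norm_num) (by norm_num) (by norm_num) (by norm_num) (by norm_num)
    linarith
  · have := key (-1) (-1) (-1/2) (by norm_num) (by norm_num) (by norm_num) (by norm_num) (by norm_num)
    linarith
  · have := key (-1) 2 2 (by norm_num) (by norm_num) (by norm_num) (by norm_num) (by norm_num)
    linarith
  · have := key 2 (-6) (-5) (by norm_num) (by norm_num) (by norm_num) (by norm_num) (by norm_num)
    linarith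

lemma mem_convexHull_four {S : Set Pt} {A B C D p : Pt} (hA : A ∈ S) (hB : B ∈ S) (hC : C ∈ S)
    (hD : D ∈ S) (hS : Convex ℝ S) (a b c d : ℝ) (ha : 0 ≤ a) (hb : 0 ≤ b) (hc : 0 ≤ c)
    (hd : 0 ≤ d) (h : a + b + c + d = 1)
    (h1 : p = (a * A.1 + b * B.1 + c * C.1 + d * D.1, a * A.2 + b * B.2 + c * C.2 + d * D.2)) :
    p ∈ S := by
  have := hS.sum_mem (t := Finset.univ) (w := ![a, b, c, d]) (z := ![A, B, C, D])
    (by intro i _; fin_cases i <;> simpa) (by simp [Fin.sum_univ_four, h])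
    (by intro i _; fin_cases i <;> simpa)
  convert this using 1
  rw [h1]
  ext <;> simp [Fin.sum_univ_four]

lemma Q_of_strict {p : Pt} (h1 : p.1 < 0) (h2 : 1 / 2 < p.1 + p.2) (h3 : 2 * p.2 - p.1 < 2)
    (h4 : 5 < 6 * p.2 - 2 * p.1) : p ∈ interior Qquad := by
  rw [mem_interior]
  refine ⟨{q : Pt | q.1 < 0 ∧ 1 / 2 < q.1 + q.2 ∧ 2 * q.2 - q.1 < 2 ∧ 5 < 6 * q.2 - 2 * q.1},
    ?_, ?_, ⟨h1, h2, h3, h4⟩⟩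
  · rintro ⟨x, y⟩ ⟨h1, h2, h3, h4⟩
    simp only at h1 h2 h3 h4
    have hmem : ∀ q ∈ ({(0, 1), (0, 5/6), (-1/4, 3/4), (-1/3, 5/6)} : Set Pt), q ∈ Qquad :=
      fun q hq => subset_convexHull ℝ _ hq
    have hconv : Convex ℝ Qquad := convex_convexHull ℝ _
    have m1 : ((0, 1) : Pt) ∈ Qquad := hmem _ (by simp)
    have m2 : ((0, 5/6) : Pt) ∈ Qquad := hmem _ (by simp)
    have m3 : ((-1/4, 3/4) : Pt) ∈ Qquad := hmem _ (by simp)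
    have m4 : ((-1/3, 5/6) : Pt) ∈ Qquad := hmem _ (by simp)
    rcases le_total y (5/6) with h | h
    · -- triangle (0,5/6), (-1/4,3/4), (-1/3,5/6)
      refine mem_convexHull_four m1 m2 m3 m4 hconv 0 (3 * (x + y - 1/2))
        (12 * (5/6 - y)) (1 - 3 * (x + y - 1/2) - 12 * (5/6 - y)) (by norm_num) (by linarith) (by linarith)
        (by linarith) (by ring) ?_
      ext <;> simp <;> ring
    · -- triangle (0,1), (0,5/6), (-1/3,5/6)
      refine mem_convexHull_four m1 m2 m3 m4 hconv (6 * (y - 5/6))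
        (1 - 6 * (y - 5/6) + 3 * x) 0 (-3 * x) (by linarith) (by linarith) (by norm_num)
        (by linarith) (by ring) ?_
      ext <;> simp <;> ring
  · simp only [ofPred_and]
    refine IsOpen.inter ?_ (IsOpen.inter ?_ (IsOpen.inter ?_ ?_)) <;>
      apply isOpen_lt <;> fun_prop

/-- The points of `D₁` in counterclockwise order. -/
def uu : Fin 10 → Pt :=
  ![(2, 0), (2, 1/2), (3/2, 1), (1/2, 1), (-1, 1/2),
    (-2, 0), (-2, -1/2), (-3/2, -1), (-1/2, -1), (1, -1/2)]

lemma range_uu : Set.range uu = D1 := by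
  ext p
  simp only [uu, D1, Set.mem_range, Fin.exists_fin_succ, Set.mem_insert_iff, Set.mem_singleton_iff]
  simp [eq_comm]
  tauto

/-- The vertices of the decagon with vertex `(x, y)`, in counterclockwise order. -/
def ww (x y : ℝ) : Fin 10 → Pt :=
  ![(2 + x, y - 1), (2 - x, 1 - y), (2 + x, y), (1 - x, 2 - y), (x, y),
    (-(2 + x), -(y - 1)), (-(2 - x), -(1 - y)), (-(2 + x), -y), (-(1 - x), -(2 - y)), (-x, -y)]

lemma ww_midpoint (x y : ℝ) (k : Fin 10) : midpoint ℝ (ww x y k) (ww x y (k + 1)) = uu k := by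
  fin_cases k <;> simp [ww, uu, midpoint_eq_smul_add] <;> (try constructor) <;> ring

lemma ww_neg (x y : ℝ) (k : Fin 10) : ww x y (k + 5) = - ww x y k := by
  fin_cases k <;> simp [ww]

lemma orient_ww {x y : ℝ} (h1 : x < 0) (h2 : 1 / 2 < x + y) (h3 : 2 * y - x < 2)
    (h4 : 5 < 6 * y - 2 * x) (i j : Fin 10) (hi : j ≠ i) (hj : j ≠ i + 1) :
    0 < orient (ww x y i) (ww x y (i + 1)) (ww x y j) := by
  fin_cases i <;> fin_cases j <;> first | (exact absurd rfl hi) | (exact absurd rfl hj) |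
    (simp [ww, orient]; nlinarith)

lemma fin_ne_add_one (i : Fin 10) : i ≠ i + 1 := by revert i; decide

lemma fin_ne_add_two (i : Fin 10) : i ≠ i + 1 + 1 := by revert i; decide

lemma orient_left (a b : Pt) : orient a b a = 0 := by simp [orient]

lemma orient_right (a b : Pt) : orient a b b = 0 := by simp only [orient]; ring

lemma orient_swap (a b p : Pt) : orient a b p = - orient a p b := by simp only [orient]; ring

lemma orient_rot (a b p : Pt) : orient a b p = orient b p a := by simp only [orient]; ring

lemma hull_pos_or {w : Fin 10 → Pt}
    (hw : ∀ i j : Fin 10, j ≠ i → j ≠ i + 1 → 0 < orient (w i) (w (i + 1)) (w j))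
    (i : Fin 10) {p : Pt} (hp : p ∈ convexHull ℝ (Set.range w)) :
    0 < orient (w i) (w (i + 1)) p ∨ p ∈ segment ℝ (w i) (w (i + 1)) := by
  have hconv : Convex ℝ {p : Pt | 0 < orient (w i) (w (i + 1)) p ∨
      p ∈ segment ℝ (w i) (w (i + 1))} := by
    rw [convex_iff_forall_pos]
    rintro p hp q hq s t hs ht hst
    simp only [mem_ofPred_eq] at *
    rw [orient_comb _ _ _ _ _ _ hst]
    rcases hp with hp | hp <;> rcases hq with hq | hq
    · left; positivity
    · left; rw [orient_of_mem_segment hq]; simp only [mul_zero, add_zero]; positivity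
    · left; rw [orient_of_mem_segment hp]; simp only [mul_zero, zero_add]; positivity
    · right; exact convex_segment _ _ hp hq hs.le ht.le hst
  refine convexHull_min ?_ hconv hp
  rintro _ ⟨j, rfl⟩
  simp only [mem_ofPred_eq]
  by_cases h1 : j = i
  · right; rw [h1]; exact left_mem_segment ℝ _ _
  by_cases h2 : j = i + 1
  · right; rw [h2]; exact right_mem_segment ℝ _ _
  exact Or.inl (hw i j h1 h2)

lemma hull_nonneg {w : Fin 10 → Pt}
    (hw : ∀ i j : Fin 10, j ≠ i → j ≠ i + 1 → 0 < orient (w i) (w (i + 1)) (w j))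
    (i : Fin 10) {p : Pt} (hp : p ∈ convexHull ℝ (Set.range w)) :
    0 ≤ orient (w i) (w (i + 1)) p := by
  rcases hull_pos_or hw i hp with h | h
  · exact h.le
  · exact (orient_of_mem_segment h).ge

lemma generic_inj {w : Fin 10 → Pt}
    (hw : ∀ i j : Fin 10, j ≠ i → j ≠ i + 1 → 0 < orient (w i) (w (i + 1)) (w j)) :
    Function.Injective w := by
  intro i j hij
  by_contra hne
  have h1 : j = i + 1 := by
    by_contra h
    have := hw i j (Ne.symm hne) h
    rw [← hij, orient_left] at this
    exact lt_irrefl _ this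
  have h2 : i ≠ j + 1 := by rw [h1]; exact fin_ne_add_two i
  have := hw j i hne h2
  rw [hij, orient_left] at this
  exact lt_irrefl _ this

lemma generic_edge {w : Fin 10 → Pt}
    (hw : ∀ i j : Fin 10, j ≠ i → j ≠ i + 1 → 0 < orient (w i) (w (i + 1)) (w j)) (i : Fin 10) :
    IsEdgeOf (convexHull ℝ (Set.range w)) (w i) (w (i + 1)) := by
  refine ⟨fun h => ?_, ?_, ?_⟩
  · exact fin_ne_add_one i (generic_inj hw h)
  · exact (convex_convexHull ℝ _).segment_subset (subset_convexHull ℝ _ ⟨i, rfl⟩)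
      (subset_convexHull ℝ _ ⟨i + 1, rfl⟩)
  · rintro p hp q hq z hz ⟨s, t, hs, ht, hst, rfl⟩
    rcases hull_pos_or hw i hp with h | h
    · exfalso
      have h0 := orient_of_mem_segment hz
      rw [orient_comb _ _ _ _ _ _ hst] at h0
      have h2 := hull_nonneg hw i hq
      have : 0 < s * orient (w i) (w (i + 1)) p := by positivity
      have : 0 ≤ t * orient (w i) (w (i + 1)) q := by positivity
      linarith
    · exact h

lemma generic_extreme {w : Fin 10 → Pt}
    (hw : ∀ i j : Fin 10, j ≠ i → j ≠ i + 1 → 0 < orient (w i) (w (i + 1)) (w j)) :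
    Set.extremePoints ℝ (convexHull ℝ (Set.range w)) = Set.range w := by
  apply Subset.antisymm extremePoints_convexHull_subset
  rintro _ ⟨i, rfl⟩
  exact left_mem_extreme (generic_edge hw i)

lemma generic_midpoints {w : Fin 10 → Pt}
    (hw : ∀ i j : Fin 10, j ≠ i → j ≠ i + 1 → 0 < orient (w i) (w (i + 1)) (w j)) :
    edgeMidpoints (convexHull ℝ (Set.range w)) =
      Set.range (fun i => midpoint ℝ (w i) (w (i + 1))) := by
  ext p
  constructor
  · rintro ⟨a, b, h, rfl⟩
    have ha := left_mem_extreme h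
    have hb := right_mem_extreme h
    rw [generic_extreme hw] at ha hb
    obtain ⟨i, rfl⟩ := ha
    obtain ⟨j, rfl⟩ := hb
    by_cases h1 : j = i + 1
    · exact ⟨i, by rw [h1]⟩
    by_cases h2 : i = j + 1
    · exact ⟨j, by rw [h2]; exact midpoint_comm _ _⟩
    exfalso
    have hij : j ≠ i := fun e => h.1 (by rw [e])
    have e : (i - 1) + 1 = i := sub_add_cancel i 1
    have h3 := hw i j hij h1
    have h4 := hw (i - 1) j (fun e' => h2 (by rw [e', e])) (by rw [e]; exact hij)
    rw [e] at h4
    refine edge_side (convex_convexHull ℝ _) h (subset_convexHull ℝ _ ⟨i - 1, rfl⟩)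
      (subset_convexHull ℝ _ ⟨i + 1, rfl⟩) ?_ ?_
    · rwa [← orient_rot]
    · rw [orient_swap]; linarith
  · rintro ⟨i, rfl⟩
    exact ⟨_, _, generic_edge hw i, rfl⟩

lemma part_b (v : Pt) (hv : v ∈ interior Qquad) : ∃ P : Set Pt, IsConvexPolygon P 10 ∧ P = -P ∧
      edgeMidpoints P = D1 ∧ v ∈ Set.extremePoints ℝ P := by
  obtain ⟨x, y⟩ := v
  obtain ⟨h1, h2, h3, h4⟩ := Q_strict hv
  have hw := orient_ww h1 h2 h3 h4
  have hmid : edgeMidpoints (convexHull ℝ (Set.range (ww x y))) = D1 := by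
    rw [generic_midpoints hw, ← range_uu]
    congr 1
    funext k
    exact ww_midpoint x y k
  have hext := generic_extreme hw
  have hconv := convex_convexHull ℝ (Set.range (ww x y))
  refine ⟨convexHull ℝ (Set.range (ww x y)),
    ⟨hconv, (Set.finite_range _).isCompact_convexHull ℝ, ?_, ?_, ?_, ?_⟩, ?_, hmid, ?_⟩
  · have hD : ∀ q ∈ D1, q ∈ convexHull ℝ (Set.range (ww x y)) := by
      intro q hq
      rw [← hmid] at hq
      obtain ⟨a, b, hab, rfl⟩ := hq
      exact hab.2.subset (midpoint_mem_segment (𝕜 := ℝ) a b)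
    have m1 := hD (2, 0) (by simp [D1])
    have m2 := hD (1/2, 1) (by simp [D1])
    have m3 := hD (-2, 0) (by simp [D1])
    have m4 := hD (-1/2, -1) (by simp [D1])
    refine ⟨(0, 0), mem_interior.mpr ⟨{q : Pt | |q.1 / 2 - q.2 / 4| + |q.2| < 1}, ?_, ?_, ?_⟩⟩
    · rintro ⟨p, q⟩ hpq
      simp only [mem_ofPred_eq] at hpq
      set α := p / 2 - q / 4 with hα
      set r := (1 - |α| - |q|) / 4 with hr
      have hα1 := abs_nonneg α
      have ha2 := neg_abs_le α
      have ha3 := le_abs_self α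
      have hq2 := neg_abs_le q
      have hq3 := le_abs_self q
      refine mem_convexHull_four m1 m2 m3 m4 hconv ((|α| + α) / 2 + r) ((|q| + q) / 2 + r)
        ((|α| - α) / 2 + r) ((|q| - q) / 2 + r) (by linarith) (by linarith) (by linarith)
        (by linarith) (by rw [hr]; ring) ?_
      ext
      · simp only
        have : p = 2 * α + q / 2 := by rw [hα]; ring
        linarith
      · simp only
        ring
    · exact isOpen_lt (by fun_prop) (by fun_prop)
    · simp
  · rw [hext]; exact Set.finite_range _
  · rw [hext, ← Set.image_univ, Set.ncard_image_of_injective _ (generic_inj hw)]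
    simp [Set.ncard_univ]
  · rw [hext]
  · rw [← convexHull_neg]
    congr 1
    ext p
    simp only [Set.mem_range, Set.mem_neg]
    constructor
    · rintro ⟨k, rfl⟩
      exact ⟨k + 5, ww_neg x y k⟩
    · rintro ⟨k, hk⟩
      exact ⟨k + 5, by rw [ww_neg, hk, neg_neg]⟩
  · rw [hext]
    exact ⟨4, by simp [ww]⟩

/-- The determinant of two plane vectors. -/
def cross (p q : Pt) : ℝ := p.1 * q.2 - p.2 * q.1

lemma uu_inj : Function.Injective uu := by
  intro i j h
  fin_cases i <;> fin_cases j <;> first | rfl | (exfalso; norm_num [uu] at h)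

lemma cross_uu_succ (k : Fin 10) : 0 ≤ cross (uu k) (uu (k + 1)) := by
  fin_cases k <;> simp [uu, cross] <;> norm_num

lemma cross_uu_cases (k l : Fin 10) : l = k ∨ 0 ≤ cross (uu (k + 1)) (uu l) ∨
    (0 ≤ cross (uu (k + 5)) (uu l) ∧ l ≠ k + 5) := by
  fin_cases k <;> fin_cases l <;> first
    | (left; rfl)
    | (right; left; (simp [uu, cross] <;> norm_num); done)
    | (right; right; refine ⟨?_, by decide⟩; (simp [uu, cross] <;> norm_num); done)

lemma uu_opp (k : Fin 10) : uu (k + 5) = - uu k := by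
  fin_cases k <;> simp [uu] <;> norm_num

lemma orient_cone (a b p q : Pt) (α β : ℝ) :
    orient a b (α • p + β • q) =
      α * orient a b p + β * orient a b q + (1 - α - β) * orient a b 0 := by
  simp only [orient, Prod.fst_add, Prod.snd_add, Prod.smul_fst, Prod.smul_snd, smul_eq_mul,
    Prod.fst_zero, Prod.snd_zero]
  ring

lemma cone_decomp {p q u : Pt} (h : 0 < cross p q) :
    u = (cross u q / cross p q) • p + (cross p u / cross p q) • q := by
  have h' := h.ne'
  ext
  · simp only [Prod.fst_add, Prod.smul_fst, smul_eq_mul]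
    field_simp
    simp only [cross]
    ring
  · simp only [Prod.snd_add, Prod.smul_snd, smul_eq_mul]
    field_simp
    simp only [cross]
    ring

lemma mid_coords {a b u : Pt} (h : u = midpoint ℝ a b) :
    b.1 = 2 * u.1 - a.1 ∧ b.2 = 2 * u.2 - a.2 := by
  rw [h, midpoint_eq_smul_add]
  simp only [Prod.smul_fst, Prod.smul_snd, Prod.fst_add, Prod.snd_add, smul_eq_mul, invOf_eq_inv]
  constructor <;> ring

lemma part_a (P : Set Pt) (hP : IsConvexPolygon P 10) (hsym : P = -P)
    (hmid : edgeMidpoints P = D1) : ∃ v ∈ Set.extremePoints ℝ P, v ∈ interior Qquad := by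
  obtain ⟨hconv, -, -, hfin, hcard, -⟩ := hP
  have hneg : ∀ p ∈ P, -p ∈ P := by
    intro p hp
    rw [hsym]
    simpa using hp
  have huP : ∀ k, uu k ∈ P := by
    intro k
    have hk : uu k ∈ edgeMidpoints P := by rw [hmid, ← range_uu]; exact ⟨k, rfl⟩
    obtain ⟨a, b, hab, h⟩ := hk
    rw [h]
    exact hab.2.subset (midpoint_mem_segment (𝕜 := ℝ) a b)
  have h0mem : ∀ p : Pt, (0 : Pt) ∈ openSegment ℝ p (-p) := fun p =>
    ⟨1/2, 1/2, by norm_num, by norm_num, by norm_num, by simp⟩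
  have h0P : (0 : Pt) ∈ P :=
    hconv.openSegment_subset (huP 0) (hneg _ (huP 0)) (h0mem _)
  have hex : ∀ k, ∃ a b : Pt, IsEdgeOf P a b ∧ uu k = midpoint ℝ a b ∧ 0 < orient a b 0 := by
    intro k
    have hk : uu k ∈ edgeMidpoints P := by rw [hmid, ← range_uu]; exact ⟨k, rfl⟩
    obtain ⟨a, b, hab, h⟩ := hk
    rcases lt_trichotomy (orient a b 0) 0 with h0 | h0 | h0
    · refine ⟨b, a, hab.symm', by rw [h]; exact midpoint_comm _ _, ?_⟩
      have : orient b a 0 = - orient a b 0 := by simp only [orient]; ring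
      linarith
    · exfalso
      have hs := mem_segment_of_orient hab h0P h0
      have hall : ∀ p ∈ P, orient a b p = 0 := fun p hp =>
        orient_of_mem_segment
          (hab.2.left_mem_of_mem_openSegment hp (hneg p hp) hs (h0mem p))
      have e0 := hall _ (huP 0)
      have e1 := hall _ (huP 1)
      have e5 := hall _ (huP 5)
      simp [orient, uu] at e0 e1 e5
      exact hab.1 (Prod.ext (by linarith) (by linarith))
    · exact ⟨a, b, hab, h, h0⟩
  choose a b hE hm h0 using hex
  have hnn : ∀ k, ∀ p ∈ P, 0 ≤ orient (a k) (b k) p := by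
    intro k p hp
    by_contra hlt
    exact edge_side hconv (hE k) h0P hp (h0 k) (not_le.mp hlt)
  have hseg : ∀ j k, uu j ∈ segment ℝ (a k) (b k) → j = k := by
    intro j k hjk
    have haP := extremePoints_subset (left_mem_extreme (hE j))
    have hbP := extremePoints_subset (right_mem_extreme (hE j))
    have hop : uu j ∈ openSegment ℝ (a j) (b j) := by
      rw [hm j, midpoint_eq_smul_add]
      exact ⟨1/2, 1/2, by norm_num, by norm_num, by norm_num, by simp⟩
    have h1 := (hE k).2.left_mem_of_mem_openSegment haP hbP hjk hop
    have h2 := (hE k).2.right_mem_of_mem_openSegment haP hbP hjk hop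
    have h1' := eq_or_eq_of_extreme (hE k) (left_mem_extreme (hE j)) h1
    have h2' := eq_or_eq_of_extreme (hE k) (right_mem_extreme (hE j)) h2
    have hne := (hE j).1
    apply uu_inj
    rcases h1' with e1 | e1 <;> rcases h2' with e2 | e2
    · exact absurd (e1.trans e2.symm) hne
    · rw [hm j, hm k, e1, e2]
    · rw [hm j, hm k, e1, e2]; exact midpoint_comm _ _
    · exact absurd (e1.trans e2.symm) hne
  have hpos : ∀ k j, j ≠ k → 0 < orient (a k) (b k) (uu j) := by
    intro k j hjk
    refine lt_of_le_of_ne (hnn k _ (huP j)) fun h => hjk (hseg j k ?_)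
    exact mem_segment_of_orient (hE k) (huP j) h.symm
  have hco := fun k => mid_coords (hm k)
  have hainj : Function.Injective a := by
    intro k l hkl
    by_contra hne
    have h1 := hpos k l (Ne.symm hne)
    have h2 := hpos l k hne
    obtain ⟨k1, k2⟩ := hco k
    obtain ⟨l1, l2⟩ := hco l
    simp only [orient, ← hkl, k1, k2, l1, l2] at h1 h2
    nlinarith
  have hrange : Set.range a = Set.extremePoints ℝ P := by
    apply Set.eq_of_subset_of_ncard_le _ _ hfin
    · rintro _ ⟨k, rfl⟩
      exact left_mem_extreme (hE k)
    · rw [hcard, ← Set.image_univ, Set.ncard_image_of_injective _ hainj]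
      simp [Set.ncard_univ]
  have lemA : ∀ k j : Fin 10, ∀ p q : Pt, p ∈ segment ℝ (a k) (b k) → q ∈ segment ℝ (a k) (b k) →
      0 < cross p q → 0 ≤ cross p (uu j) → 0 ≤ cross (uu j) q → j = k := by
    intro k j p q hp hq hpq h1 h2
    by_contra hne
    have h3 := hpos k j hne
    have hdec := cone_decomp (u := uu j) hpq
    set α := cross (uu j) q / cross p q
    set β := cross p (uu j) / cross p q
    have hα : 0 ≤ α := div_nonneg h2 hpq.le
    have hβ : 0 ≤ β := div_nonneg h1 hpq.le
    have h4 : orient (a j) (b j) (uu j) = 0 :=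
      orient_of_mem_segment (by rw [hm j]; exact midpoint_mem_segment (𝕜 := ℝ) _ _)
    rw [hdec, orient_cone] at h3 h4
    rw [orient_of_mem_segment hp, orient_of_mem_segment hq] at h3
    have h5 : 0 < 1 - α - β := by
      simp only [mul_zero, zero_add] at h3
      exact pos_of_mul_pos_left h3 (h0 k).le
    have h6 := mul_nonneg hα (hnn j p ((hE k).2.subset hp))
    have h7 := mul_nonneg hβ (hnn j q ((hE k).2.subset hq))
    have h8 := mul_pos h5 (h0 j)
    linarith
  have hub : ∀ k, 0 < cross (uu k) (b k) := by
    intro k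
    have := h0 k
    obtain ⟨k1, k2⟩ := hco k
    simp only [orient, cross, Prod.fst_zero, Prod.snd_zero, k1, k2] at this ⊢
    nlinarith
  have hau : ∀ k, 0 < cross (a k) (uu k) := by
    intro k
    have := h0 k
    obtain ⟨k1, k2⟩ := hco k
    simp only [orient, cross, Prod.fst_zero, Prod.snd_zero, k1, k2] at this ⊢
    nlinarith
  have hus : ∀ k, uu k ∈ segment ℝ (a k) (b k) := by
    intro k
    rw [hm k]
    exact midpoint_mem_segment (𝕜 := ℝ) _ _
  have hnext : ∀ k, b k = a (k + 1) := by
    intro k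
    have hbk : b k ∈ Set.range a := by rw [hrange]; exact right_mem_extreme (hE k)
    obtain ⟨l, hl⟩ := hbk
    have hlk : l ≠ k := by
      rintro rfl
      exact (hE l).1 hl
    suffices l = k + 1 by rw [← this, hl]
    have hbl : b k ∈ segment ℝ (a l) (b l) := by rw [← hl]; exact left_mem_segment ℝ _ _
    have hbul : 0 < cross (b k) (uu l) := by rw [← hl]; exact hau l
    rcases le_total 0 (cross (uu (k + 1)) (b k)) with hc | hc
    · exfalso
      exact fin_ne_add_one k
        (lemA k (k + 1) _ _ (hus k) (right_mem_segment ℝ _ _) (hub k) (cross_uu_succ k) hc).symm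
    · rcases cross_uu_cases k l with h | h | ⟨h, h'⟩
      · exact absurd h hlk
      · refine (lemA l (k + 1) _ _ hbl (hus l) hbul ?_ h).symm
        have : cross (b k) (uu (k + 1)) = - cross (uu (k + 1)) (b k) := by simp only [cross]; ring
        linarith
      · exfalso
        refine h' (lemA l (k + 5) _ _ hbl (hus l) hbul ?_ h).symm
        have : cross (b k) (uu (k + 5)) = cross (uu k) (b k) := by
          rw [uu_opp]; simp only [cross, Prod.fst_neg, Prod.snd_neg]; ring
        rw [this]
        exact (hub k).le
  refine ⟨a 4, left_mem_extreme (hE 4), ?_⟩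
  have n0 := hnext 0
  have n1 := hnext 1
  have n2 := hnext 2
  have n3 := hnext 3
  have n4 := hnext 4
  have p0 := hpos 0 1 (by decide)
  have p1 := hpos 1 2 (by decide)
  have p3 := hpos 3 4 (by decide)
  have p4 := hpos 4 5 (by decide)
  obtain ⟨c0, d0⟩ := hco 0
  obtain ⟨c1, d1⟩ := hco 1
  obtain ⟨c2, d2⟩ := hco 2
  obtain ⟨c3, d3⟩ := hco 3
  obtain ⟨c4, d4⟩ := hco 4
  simp only [show (0 : Fin 10) + 1 = 1 from rfl, show (1 : Fin 10) + 1 = 2 from rfl,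
    show (2 : Fin 10) + 1 = 3 from rfl, show (3 : Fin 10) + 1 = 4 from rfl] at n0 n1 n2 n3
  simp only [orient, c0, d0, c1, d1, c3, d3, c4, d4] at p0 p1 p3 p4
  rw [n0] at c0 d0
  rw [n1] at c1 d1
  rw [n2] at c2 d2
  rw [n3] at c3 d3
  simp [uu] at c0 d0 c1 d1 c2 d2 c3 d3 p0 p1 p3 p4
  have x3 : (a 3).1 = 1 - (a 4).1 := by linarith
  have y3 : (a 3).2 = 2 - (a 4).2 := by linarith
  have x2 : (a 2).1 = 2 + (a 4).1 := by linarith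
  have y2 : (a 2).2 = (a 4).2 := by linarith
  have x1 : (a 1).1 = 2 - (a 4).1 := by linarith
  have y1 : (a 1).2 = 1 - (a 4).2 := by linarith
  have x0 : (a 0).1 = 2 + (a 4).1 := by linarith
  have y0 : (a 0).2 = (a 4).2 - 1 := by linarith
  rw [x0, y0] at p0
  rw [x1, y1] at p1
  rw [x3, y3] at p3
  apply Q_of_strict <;> nlinarith

/-- (a) every centrally symmetric convex decagon centered at the origin with edge
midpoint set `D₁` has a vertex in the interior of `Q`; (b) every point of the interior of `Q` is
a vertex of such a decagon. -/
theorem decagonD1_vertex_in_Q :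
    (∀ P : Set Pt, IsConvexPolygon P 10 → P = -P → edgeMidpoints P = D1 →
      ∃ v ∈ Set.extremePoints ℝ P, v ∈ interior Qquad) ∧
    (∀ v ∈ interior Qquad, ∃ P : Set Pt, IsConvexPolygon P 10 ∧ P = -P ∧
      edgeMidpoints P = D1 ∧ v ∈ Set.extremePoints ℝ P) := by
  exact ⟨part_a, part_b⟩
end
end

section
/- Let P be a centrally symmetric convex polygon in ℝ² with exactly 14 vertices (a centrally symmetric convex tetradecagon). Then for every discrete multiset X in ℝ² and every positive integer k ≤ 6, P + X is not a k-fold translative tiling of ℝ²; that is, τ(P) ≥ 7. -/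
open Set Pointwise

noncomputable section

/-! ### The combinatorial part -/

/-- The planar determinant. -/
def dt (p q : Pt) : ℝ := p.1 * q.2 - p.2 * q.1

theorem dt_add (p q r : Pt) : dt p (q + r) = dt p q + dt p r := by
  simp only [dt, Prod.fst_add, Prod.snd_add]; ring

theorem dt_sub (p q r : Pt) : dt p (q - r) = dt p q - dt p r := by
  simp only [dt, Prod.fst_sub, Prod.snd_sub]; ring

theorem dt_neg (p q : Pt) : dt p (-q) = - dt p q := by
  simp only [dt, Prod.fst_neg, Prod.snd_neg]; ring

theorem dt_smul (p q : Pt) (a : ℝ) : dt p (a • q) = a * dt p q := by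
  simp only [dt, Prod.smul_fst, Prod.smul_snd, smul_eq_mul]; ring

/-- The linear functional attached to the `s`-th edge. -/
def yy (v : ℤ → Pt) (s : ℤ) (p : Pt) : ℝ := dt (v (s + 1) - v s) p

/-- Antiperiodic system of vertices whose edges turn left, by less than a half turn in seven steps. -/
structure Gon (v : ℤ → Pt) : Prop where
  anti : ∀ i, v (i + 7) = - v i
  edge : ∀ i j, i < j → j < i + 7 → 0 < dt (v (i + 1) - v i) (v (j + 1) - v j)

/-- closed polygon -/
def inC (v : ℤ → Pt) (p : Pt) : Prop := ∀ s, yy v s (v s) ≤ yy v s p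
/-- open polygon -/
def inO (v : ℤ → Pt) (p : Pt) : Prop := ∀ s, yy v s (v s) < yy v s p
/-- `p + ε u` is in the polygon for small `ε`. -/
def inT (v : ℤ → Pt) (u p : Pt) : Prop :=
  ∀ s, yy v s (v s) < yy v s p ∨ (yy v s p = yy v s (v s) ∧ 0 < yy v s u)

section gon
variable {v : ℤ → Pt} (hv : Gon v)
include hv

theorem Gon.v14 (l n : ℤ) : v (l + 14 * n) = v l := by
  have h : ∀ m, v (m + 14) = v m := fun m => by
    rw [show m + 14 = (m + 7) + 7 by ring, hv.anti, hv.anti, neg_neg]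
  induction n using Int.induction_on with
  | zero => simp
  | succ n ih => rw [← ih, ← h (l + 14 * n)]; congr 1; ring
  | pred n ih => rw [← ih, ← h]; congr 1; ring

theorem Gon.y14 (s n : ℤ) (p : Pt) : yy v (s + 14 * n) p = yy v s p := by
  unfold yy
  rw [show s + 14 * n + 1 = (s + 1) + 14 * n by ring, hv.v14, hv.v14]

theorem Gon.y7 (s : ℤ) (p : Pt) : yy v (s + 7) p = - yy v s p := by
  unfold yy
  rw [show s + 7 + 1 = (s + 1) + 7 by ring, hv.anti, hv.anti]
  simp only [dt, Prod.fst_sub, Prod.snd_sub, Prod.fst_neg, Prod.snd_neg]; ring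

theorem Gon.f7 (s l : ℤ) : yy v s (v (l + 7)) = - yy v s (v l) := by
  unfold yy; rw [hv.anti, dt_neg]

omit hv in
theorem yself (s : ℤ) : yy v s (v (s + 1)) = yy v s (v s) := by
  simp only [yy, dt, Prod.fst_sub, Prod.snd_sub]; ring

theorem Gon.rise (s a b : ℤ) (h1 : s < a) (h2 : a < b) (h3 : b ≤ s + 7) :
    yy v s (v a) < yy v s (v b) := by
  have step : ∀ t, s < t → t < s + 7 → yy v s (v t) < yy v s (v (t + 1)) := by
    intro t h1 h2
    have := hv.edge s t h1 h2
    rw [dt_sub] at this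
    unfold yy; linarith
  obtain ⟨n, rfl⟩ : ∃ n : ℕ, b = a + 1 + n := ⟨(b - a - 1).toNat, by omega⟩
  clear h2
  induction n with
  | zero => simpa using step a h1 (by push_cast at h3; omega)
  | succ n ih =>
    have := step (a + 1 + n) (by omega) (by push_cast at h3; omega)
    have h := ih (by push_cast at h3; omega)
    push_cast
    rw [← add_assoc]
    linarith

theorem Gon.fall (s a b : ℤ) (h1 : s + 7 < a) (h2 : a < b) (h3 : b ≤ s + 14) :
    yy v s (v b) < yy v s (v a) := by
  have := hv.rise s (a - 7) (b - 7) (by omega) (by omega) (by omega)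
  have h1 := hv.f7 s (a - 7)
  have h2 := hv.f7 s (b - 7)
  simp only [sub_add_cancel] at h1 h2
  linarith

theorem Gon.mneg (s : ℤ) : yy v s (v s) < 0 := by
  have h1 := hv.rise s (s + 1) (s + 7) (by omega) (by omega) (by omega)
  have h2 := hv.f7 s s
  have h3 := yself (v := v) s
  linarith

theorem Gon.min_strict (s l : ℤ) (h1 : s + 1 < l) (h2 : l < s + 14) :
    yy v s (v s) < yy v s (v l) := by
  have h3 := yself (v := v) s
  by_cases h : l ≤ s + 7
  · have := hv.rise s (s + 1) l (by omega) h1 h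
    linarith
  · have h4 := hv.fall s l (s + 14) (by omega) h2 (by omega)
    have h5 := hv.v14 s 1
    rw [mul_one] at h5
    rwa [h5] at h4

omit hv in
theorem mod14 (s l : ℤ) : ∃ n r, l = r + 14 * n ∧ s ≤ r ∧ r < s + 14 :=
  ⟨(l - s) / 14, s + (l - s) % 14, by omega, by omega, by omega⟩

theorem Gon.eq_min (s l : ℤ) (h : yy v s (v l) ≤ yy v s (v s)) :
    ∃ n, l = s + 14 * n ∨ l = s + 1 + 14 * n := by
  obtain ⟨n, r, rfl, h1, h2⟩ := mod14 s l
  rw [hv.v14] at h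
  refine ⟨n, ?_⟩
  by_contra hc
  have := hv.min_strict s r (by omega) h2
  linarith

theorem Gon.min (s l : ℤ) : yy v s (v s) ≤ yy v s (v l) := by
  by_contra hc
  obtain ⟨n, h | h⟩ := hv.eq_min s l (by linarith)
  · rw [h, hv.v14] at hc; exact hc le_rfl
  · rw [h, hv.v14, yself] at hc; exact hc le_rfl

theorem Gon.max (s l : ℤ) : yy v s (v l) ≤ - yy v s (v s) := by
  have := hv.min s (l + 7)
  rw [hv.f7] at this; linarith

theorem Gon.inj (a b : ℤ) (h1 : a < b) (h2 : b < a + 14) : v a ≠ v b := by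
  intro h
  by_cases h3 : b = a + 1
  · have h4 := hv.min_strict (a - 1) (a + 1) (by omega) (by omega)
    have h5 := yself (v := v) (a - 1)
    simp only [sub_add_cancel] at h5
    rw [← h3, ← h] at h4
    linarith
  · have := hv.min_strict a b (by omega) h2
    rw [h] at this; exact lt_irrefl _ this

/-- The interior points of the form `v i + v j - v l`. -/
theorem Gon.interior (i l j : ℤ) (h1 : i < l) (h2 : l < j) (h3 : j < i + 7) :
    inO v (v i + (v j - v l)) := by
  intro s
  obtain ⟨n, r, rfl, h4, h5⟩ := mod14 (i - 7) s
  rw [hv.y14, hv.y14, hv.v14]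
  have e : yy v r (v i + (v j - v l)) = yy v r (v i) + (yy v r (v j) - yy v r (v l)) := by
    unfold yy; rw [dt_add, dt_sub]
  rw [e]
  by_cases c1 : i ≤ r
  · by_cases c2 : r ≤ l
    · by_cases c3 : r = i
      · subst c3
        have := hv.rise r l j h1 h2 (by omega)
        linarith
      · have a1 := hv.min_strict r (i + 14) (by omega) (by omega)
        have := hv.v14 i 1
        rw [mul_one] at this
        rw [this] at a1
        by_cases c4 : r = l
        · subst c4
          have := hv.min r j
          linarith
        · have := hv.rise r l j (by omega) h2 (by omega)
          linarith
    · have a1 := hv.min r j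
      have a2 := hv.rise r (i + 7) (l + 7) (by omega) (by omega) (by omega)
      rw [hv.f7, hv.f7] at a2
      linarith
  · by_cases c2 : r + 8 ≤ j
    · have a1 := hv.fall r j (i + 7) (by omega) (by omega) (by omega)
      rw [hv.f7] at a1
      have a2 := hv.max r l
      linarith
    · have a1 := hv.rise r l j (by omega) h2 (by omega)
      have a2 := hv.min r i
      linarith

theorem Gon.pair_inj (i l j l' j' : ℤ) (h1 : i < l) (h2 : l < j) (h3 : j < i + 7)
    (h1' : i < l') (h2' : l' < j') (h3' : j' < i + 7) (h : v j - v l = v j' - v l') :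
    l = l' ∧ j = j' := by
  have key : ∀ l j l' j' : ℤ, i < l → l < j → j < i + 7 → i < l' → l' < j' → j' < i + 7 →
      v j - v l = v j' - v l' → l < l' → False := by
    intro l j l' j' h1 h2 h3 h1' h2' h3' h hl
    have hy : ∀ s, yy v s (v j) - yy v s (v l) = yy v s (v j') - yy v s (v l') := by
      intro s; unfold yy; rw [← dt_sub, ← dt_sub, h]
    by_cases c1 : j' ≤ j
    · have a1 := hv.rise i l l' h1 hl (by omega)
      have a2 := hy i
      rcases eq_or_lt_of_le c1 with c | c
      · subst c; linarith
      · have a3 := hv.rise i j' j (by omega) c (by omega)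
        linarith
    · by_cases c2 : l' ≤ j
      · have a1 := hv.min j j'
        have a2 := hy j
        rcases eq_or_lt_of_le c2 with c | c
        · subst c
          have a3 := hv.min_strict l' (l + 14) (by omega) (by omega)
          have := hv.v14 l 1
          rw [mul_one] at this
          rw [this] at a3
          linarith
        · have a3 := hv.rise j (l + 7) (l' + 7) (by omega) (by omega) (by omega)
          rw [hv.f7, hv.f7] at a3
          linarith
      · have a1 := hv.min l' j'
        have a2 := hy l'
        have a3 := hv.rise l' (l + 7) (j + 7) (by omega) (by omega) (by omega)
        rw [hv.f7, hv.f7] at a3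
        linarith
  have hl : l = l' := by
    rcases lt_trichotomy l l' with c | c | c
    · exact (key l j l' j' h1 h2 h3 h1' h2' h3' h c).elim
    · exact c
    · exact (key l' j' l j h1' h2' h3' h1 h2 h3 h.symm c).elim
  refine ⟨hl, ?_⟩
  subst hl
  have h : v j = v j' := sub_left_injective h
  rcases lt_trichotomy j j' with c | c | c
  · exact (hv.inj j j' c (by omega) h).elim
  · exact c
  · exact (hv.inj j' j c (by omega) h.symm).elim

end gon
/-! ### Local analysis at a point -/

theorem ev_sign (a b c : ℝ) (hb : b ≠ 0) :
    ∀ᶠ ε in nhdsWithin (0 : ℝ) (Ioi 0),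
      ((c < a ∨ (a = c ∧ 0 < b)) → c < a + ε * b) ∧ (c ≤ a + ε * b → (c < a ∨ (a = c ∧ 0 < b))) := by
  have hcont : Filter.Tendsto (fun ε : ℝ => a + ε * b) (nhdsWithin (0 : ℝ) (Ioi 0)) (nhds a) := by
    have : Filter.Tendsto (fun ε : ℝ => a + ε * b) (nhds 0) (nhds (a + 0 * b)) :=
      Continuous.tendsto (by fun_prop) 0
    rw [zero_mul, add_zero] at this
    exact this.mono_left nhdsWithin_le_nhds
  rcases lt_trichotomy c a with h | h | h
  · filter_upwards [hcont.eventually (lt_mem_nhds h)] with ε hε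
    exact ⟨fun _ => hε, fun _ => Or.inl h⟩
  · subst h
    filter_upwards [self_mem_nhdsWithin] with ε hε
    have hε : (0 : ℝ) < ε := hε
    constructor
    · rintro (h | ⟨_, h⟩)
      · exact (lt_irrefl _ h).elim
      · nlinarith
    · intro h
      refine Or.inr ⟨rfl, ?_⟩
      by_contra hc
      have : b < 0 := lt_of_le_of_ne (not_lt.mp hc) hb
      nlinarith
  · filter_upwards [hcont.eventually (gt_mem_nhds h)] with ε hε
    refine ⟨?_, fun h' => by linarith⟩
    rintro (h' | ⟨h', _⟩) <;> linarith

section loc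
variable {v : ℤ → Pt} (hv : Gon v)
include hv

theorem Gon.ev_T (u q : Pt) (hu : ∀ s, yy v s u ≠ 0) :
    ∀ᶠ ε in nhdsWithin (0 : ℝ) (Ioi 0),
      (inT v u q → inO v (q + ε • u)) ∧ (inC v (q + ε • u) → inT v u q) := by
  have h := (Filter.eventually_all_finset (l := nhdsWithin (0 : ℝ) (Ioi 0)) (Finset.Ico (0 : ℤ) 14)
    (p := fun s ε => ((yy v s (v s) < yy v s q ∨ (yy v s q = yy v s (v s) ∧ 0 < yy v s u)) →
       yy v s (v s) < yy v s q + ε * yy v s u) ∧ (yy v s (v s) ≤ yy v s q + ε * yy v s u →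
       (yy v s (v s) < yy v s q ∨ (yy v s q = yy v s (v s) ∧ 0 < yy v s u))))).2
    (fun s _ => ev_sign _ _ _ (hu s))
  filter_upwards [h] with ε hε
  have e : ∀ s, yy v s (q + ε • u) = yy v s q + ε * yy v s u := by
    intro s; unfold yy; rw [dt_add, dt_smul]
  constructor
  · intro hT s
    obtain ⟨n, r, rfl, h4, h5⟩ := mod14 0 s
    rw [hv.y14, hv.y14, hv.v14, e]
    exact (hε r (Finset.mem_Ico.2 ⟨h4, by omega⟩)).1 (hT r)
  · intro hT s
    obtain ⟨n, r, rfl, h4, h5⟩ := mod14 0 s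
    rw [hv.y14, hv.y14, hv.y14, hv.v14]
    refine (hε r (Finset.mem_Ico.2 ⟨h4, by omega⟩)).2 ?_
    rw [← e]; exact hT r

/-- The tiling hypothesis in normalized form. -/
structure Til (v : ℤ → Pt) {I : Type} (x : I → Pt) (k : ℕ) (ρ : ℝ) : Prop where
  disc : ∀ R : ℝ, {i : I | ‖x i‖ ≤ R}.Finite
  bdd : ∀ q, inC v q → ‖q‖ ≤ ρ
  cov : ∀ p : Pt, (k : ℕ∞) ≤ {i : I | inC v (p - x i)}.encard
  pack : ∀ p : Pt, {i : I | inO v (p - x i)}.encard ≤ (k : ℕ∞)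

variable {I : Type} {x : I → Pt} {k : ℕ} {ρ : ℝ} (ht : Til v x k ρ)

omit hv in
theorem inT_C {u q : Pt} (h : inT v u q) : inC v q := by
  intro s
  rcases h s with h | h
  · exact h.le
  · exact h.1.ge

omit hv in
theorem inO_C {q : Pt} (h : inO v q) : inC v q := fun s => (h s).le

include ht

omit hv in
theorem Til.finC (p : Pt) : {i : I | inC v (p - x i)}.Finite := by
  refine (ht.disc (‖p‖ + ρ)).subset ?_
  intro i hi
  have h1 := ht.bdd _ hi
  have : x i = p - (p - x i) := by abel
  calc ‖x i‖ = ‖p - (p - x i)‖ := by rw [← this]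
    _ ≤ ‖p‖ + ‖p - x i‖ := norm_sub_le _ _
    _ ≤ ‖p‖ + ρ := by linarith

theorem Til.countT (p u : Pt) (hu : ∀ s, yy v s u ≠ 0) :
    {i : I | inT v u (p - x i)}.encard = k := by
  have hfin := ht.disc (‖p‖ + ‖u‖ + ρ)
  have hbig : ∀ ε : ℝ, 0 ≤ ε → ε ≤ 1 → ∀ i, inC v (p + ε • u - x i) → ‖x i‖ ≤ ‖p‖ + ‖u‖ + ρ := by
    intro ε h0 h1 i hi
    have h1 := ht.bdd _ hi
    have : x i = (p + ε • u) - (p + ε • u - x i) := by abel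
    calc ‖x i‖ = ‖(p + ε • u) - (p + ε • u - x i)‖ := by rw [← this]
      _ ≤ ‖p + ε • u‖ + ‖p + ε • u - x i‖ := norm_sub_le _ _
      _ ≤ (‖p‖ + ‖ε • u‖) + ρ := by gcongr; exact norm_add_le _ _
      _ ≤ ‖p‖ + ‖u‖ + ρ := by
        rw [norm_smul, Real.norm_of_nonneg h0]
        nlinarith [norm_nonneg u]
  have h := (Filter.eventually_all_finite (l := nhdsWithin (0 : ℝ) (Ioi 0)) hfin
    (p := fun i ε => (inT v u (p - x i) → inO v (p - x i + ε • u)) ∧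
      (inC v (p - x i + ε • u) → inT v u (p - x i)))).2 (fun i _ => hv.ev_T u _ hu)
  have h1 : ∀ᶠ ε in nhdsWithin (0 : ℝ) (Ioi 0), ε ≤ 1 :=
    nhdsWithin_le_nhds (Iic_mem_nhds zero_lt_one)
  obtain ⟨ε, hε, hε1, hε0⟩ := (h.and (h1.and self_mem_nhdsWithin)).exists
  have hε0 : (0 : ℝ) < ε := hε0
  have e : ∀ i, p - x i + ε • u = p + ε • u - x i := fun i => by abel
  apply le_antisymm
  · refine le_trans (encard_le_encard ?_) (ht.pack (p + ε • u))
    intro i hi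
    have := (hε i (hbig 0 le_rfl zero_le_one i (by simpa using inT_C hi))).1 hi
    rw [e] at this; exact this
  · refine le_trans (ht.cov (p + ε • u)) (encard_le_encard ?_)
    intro i hi
    refine (hε i (hbig ε hε0.le hε1 i hi)).2 ?_
    rw [e]; exact hi

end loc

section cls
variable {v : ℤ → Pt} (hv : Gon v)
include hv

/-- A direction between the edges `j - 1` and `j`. -/
theorem Gon.dir (j s : ℤ) (h1 : j - 7 ≤ s) (h2 : s < j) : 0 < yy v s (v (j + 1) - v (j - 1)) := by
  have e : yy v s (v (j + 1) - v (j - 1)) = yy v s (v (j + 1)) - yy v s (v (j - 1)) := by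
    unfold yy; rw [dt_sub]
  rw [e]
  by_cases c : s = j - 1
  · subst c
    have := hv.min_strict (j - 1) (j + 1) (by omega) (by omega)
    linarith
  · by_cases c2 : s = j - 7
    · subst c2
      have a1 := hv.rise (j - 7) (j - 1) j (by omega) (by omega) (by omega)
      have a2 := hv.f7 (j - 7) (j - 7 + 1)
      have a3 := hv.f7 (j - 7) (j - 7)
      have a4 := yself (v := v) (j - 7)
      rw [show j - 7 + 1 + 7 = j + 1 by ring] at a2
      rw [show j - 7 + 7 = j by ring] at a3
      linarith
    · have := hv.rise s (j - 1) (j + 1) (by omega) (by omega) (by omega)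
      linarith

theorem Gon.dir_neg (j s : ℤ) (h1 : j ≤ s) (h2 : s < j + 7) :
    yy v s (v (j + 1) - v (j - 1)) < 0 := by
  have := hv.dir j (s - 7) (by omega) (by omega)
  have h := hv.y7 (s - 7) (v (j + 1) - v (j - 1))
  rw [sub_add_cancel] at h
  linarith

theorem Gon.dir_ne (j s : ℤ) : yy v s (v (j + 1) - v (j - 1)) ≠ 0 := by
  obtain ⟨n, r, rfl, h4, h5⟩ := mod14 (j - 7) s
  rw [hv.y14]
  by_cases c : r < j
  · exact (hv.dir j r h4 c).ne'
  · exact (hv.dir_neg j r (by omega) (by omega)).ne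

theorem Gon.T_vertex (n : ℤ) (u : Pt) :
    inT v u (v n) ↔ 0 < yy v n u ∧ 0 < yy v (n - 1) u := by
  constructor
  · intro h
    constructor
    · rcases h n with h | h
      · exact (lt_irrefl _ h).elim
      · exact h.2
    · rcases h (n - 1) with h | h
      · have := yself (v := v) (n - 1)
        rw [sub_add_cancel] at this
        linarith
      · exact h.2
  · rintro ⟨h1, h2⟩ s
    by_cases c : yy v s (v s) < yy v s (v n)
    · exact Or.inl c
    · refine Or.inr ⟨le_antisymm (not_lt.mp c) (hv.min s n), ?_⟩
      obtain ⟨m, h | h⟩ := hv.eq_min s n (not_lt.mp c)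
      · subst h; rwa [hv.y14] at h1
      · subst h
        rw [show s + 1 + 14 * m - 1 = s + 14 * m by ring, hv.y14] at h2
        exact h2

/-- A boundary point that is not a vertex lies on exactly one edge. -/
theorem Gon.bd_unique (q : Pt) (hq : inC v q) (hn : ∀ n, q ≠ v n) (s : ℤ)
    (hs : yy v s q = yy v s (v s)) (t : ℤ) (htt : yy v t q = yy v t (v t)) :
    ∃ n, t = s + 14 * n := by
  -- write q = v s + τ (v (s+1) - v s)
  have hd : 0 < dt (v (s + 1) - v s) (v (s + 1 + 1) - v (s + 1)) := hv.edge s (s + 1) (by omega) (by omega)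
  obtain ⟨τ, hτ⟩ : ∃ τ : ℝ, q = v s + τ • (v (s + 1) - v s) := by
    have h0 : dt (v (s + 1) - v s) (q - v s) = 0 := by
      rw [dt_sub]; unfold yy at hs; linarith
    have hne : v (s + 1) - v s ≠ 0 := by
      intro h
      rw [h] at hd
      simp [dt] at hd
    generalize v (s + 1) - v s = e at h0 hne
    obtain ⟨d, hdd⟩ : ∃ d, d = q - v s := ⟨_, rfl⟩
    have hq : q = v s + d := by rw [hdd]; abel
    rw [← hdd] at h0
    unfold dt at h0
    rw [hq]
    by_cases c : e.1 = 0
    · have c2 : e.2 ≠ 0 := fun c2 => hne (Prod.ext c c2)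
      refine ⟨d.2 / e.2, ?_⟩
      congr 1
      ext
      · simp [c] at h0 ⊢
        tauto
      · simp; field_simp
    · refine ⟨d.1 / e.1, ?_⟩
      congr 1
      ext
      · simp; field_simp
      · simp; field_simp; linarith
  have hlin : ∀ r, yy v r q = (1 - τ) * yy v r (v s) + τ * yy v r (v (s + 1)) := by
    intro r
    rw [hτ]; unfold yy; rw [dt_add, dt_smul, dt_sub _ (v (s + 1)) (v s)]; ring
  have h0 : τ ≠ 0 := fun h => hn s (by rw [hτ, h]; simp)
  have h1 : τ ≠ 1 := fun h => hn (s + 1) (by rw [hτ, h]; simp)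
  have hpos : 0 < τ := by
    have a1 := hq (s - 1)
    rw [hlin] at a1
    have a2 := yself (v := v) (s - 1)
    rw [sub_add_cancel] at a2
    have a3 := hv.min_strict (s - 1) (s + 1) (by omega) (by omega)
    have : 0 ≤ τ := by
      by_contra hc
      nlinarith
    exact lt_of_le_of_ne this (Ne.symm h0)
  have hlt : τ < 1 := by
    have a1 := hq (s + 1)
    rw [hlin] at a1
    have a3 := hv.min_strict (s + 1) (s + 14) (by omega) (by omega)
    have a4 := hv.v14 s 1
    rw [mul_one] at a4
    rw [a4] at a3
    have : τ ≤ 1 := by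
      by_contra hc
      nlinarith
    exact lt_of_le_of_ne this h1
  rw [hlin] at htt
  have b1 := hv.min t s
  have b2 := hv.min t (s + 1)
  have c1 : yy v t (v s) ≤ yy v t (v t) := by nlinarith
  have c2 : yy v t (v (s + 1)) ≤ yy v t (v t) := by nlinarith
  obtain ⟨m1, d1⟩ := hv.eq_min _ _ c1
  obtain ⟨m2, d2⟩ := hv.eq_min _ _ c2
  rcases d1 with d1 | d1
  · exact ⟨-m1, by omega⟩
  · omega

open Classical in
theorem Gon.weight (j : ℤ) (q : Pt) (hq : inC v q) :
    (if inT v (v (j + 1) - v (j - 1)) q then 1 else 0)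
      + (if inT v (-(v (j + 1) - v (j - 1))) q then 1 else 0)
      + (if q = v j ∨ q = v (j + 7) then 1 else 0)
    = (if inO v q then 2 else 1 : ℕ) := by
  have hneg : ∀ s, yy v s (-(v (j + 1) - v (j - 1))) = - yy v s (v (j + 1) - v (j - 1)) := by
    intro s; unfold yy; rw [dt_neg]
  by_cases hO : inO v q
  · have h1 : ∀ u, inT v u q := fun u s => Or.inl (hO s)
    have h2 : ∀ n, q ≠ v n := by
      rintro n rfl
      exact lt_irrefl _ (hO n)
    simp [h1, h2, hO]
  · by_cases hV : ∃ n, q = v n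
    · obtain ⟨n, rfl⟩ := hV
      obtain ⟨m, r, rfl, h4, h5⟩ := mod14 (j - 7) n
      rw [hv.v14] at hO ⊢
      rw [if_neg hO]
      simp only [hv.T_vertex, hneg]
      have hj7 : v (j + 7) = v (j - 7) := by
        have := hv.v14 (j - 7) 1
        rw [← this]; congr 1; ring
      by_cases c1 : r = j - 7
      · subst c1
        have a1 := hv.dir j (j - 7) (by omega) (by omega)
        have a2 := hv.dir_neg j (j + 6) (by omega) (by omega)
        have a3 := hv.y14 (j - 7 - 1) 1 (v (j + 1) - v (j - 1))
        rw [show j - 7 - 1 + 14 * 1 = j + 6 by ring] at a3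
        rw [a3] at a2
        rw [if_neg, if_neg, if_pos]
        · right; exact hj7.symm
        · rintro ⟨b1, b2⟩; linarith
        · rintro ⟨b1, b2⟩; linarith
      · by_cases c2 : r = j
        · subst c2
          have a1 := hv.dir r (r - 1) (by omega) (by omega)
          have a2 := hv.dir_neg r r (by omega) (by omega)
          rw [if_neg, if_neg, if_pos]
          · left; rfl
          · rintro ⟨b1, b2⟩; linarith
          · rintro ⟨b1, b2⟩; linarith
        · have n1 : v r ≠ v j := by
            rcases lt_or_gt_of_ne c2 with c | c
            · exact hv.inj _ _ c (by omega)
            · exact (hv.inj _ _ c (by omega)).symm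
          have n2 : v r ≠ v (j + 7) := hv.inj _ _ (by omega) (by omega)
          by_cases c3 : r < j
          · have a1 := hv.dir j r (by omega) (by omega)
            have a2 := hv.dir j (r - 1) (by omega) (by omega)
            rw [if_pos ⟨a1, a2⟩, if_neg, if_neg]
            · rintro (h | h)
              · exact n1 h
              · exact n2 h
            · rintro ⟨b1, b2⟩; linarith
          · have a1 := hv.dir_neg j r (by omega) (by omega)
            have a2 := hv.dir_neg j (r - 1) (by omega) (by omega)
            rw [if_neg, if_pos, if_neg]
            · rintro (h | h)
              · exact n1 h
              · exact n2 h
            · constructor <;> linarith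
            · rintro ⟨b1, b2⟩; linarith
    · push Not at hV
      have hO' := hO
      unfold inO at hO'
      push Not at hO'
      obtain ⟨s, hs⟩ := hO'
      have hs : yy v s q = yy v s (v s) := le_antisymm hs (hq s)
      have hT : ∀ u, inT v u q ↔ 0 < yy v s u := by
        intro u
        constructor
        · intro h
          rcases h s with h | h
          · linarith
          · exact h.2
        · intro h t
          by_cases c : yy v t (v t) < yy v t q
          · exact Or.inl c
          · have e : yy v t q = yy v t (v t) := le_antisymm (not_lt.mp c) (hq t)
            refine Or.inr ⟨e, ?_⟩
            obtain ⟨n, rfl⟩ := hv.bd_unique q hq hV s hs t e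
            rw [hv.y14]; exact h
      simp only [hT, hneg, hV, hO, or_self, if_false]
      rcases lt_or_gt_of_ne (hv.dir_ne j s) with c | c
      · rw [if_neg (by linarith), if_pos (by linarith)]
      · rw [if_pos (by linarith), if_neg (by linarith)]

end cls

section locsum
variable {v : ℤ → Pt} (hv : Gon v) {I : Type} {x : I → Pt} {k : ℕ} {ρ : ℝ} (ht : Til v x k ρ)
include hv ht

open Classical in
/-- The number of tiles having `p` as the vertex `j` or `j + 7` does not depend on `j`. -/
theorem Til.local_count (p : Pt) : ∃ c : ℕ,
    (∀ j, {i : I | p - x i = v j ∨ p - x i = v (j + 7)}.ncard = c) ∧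
    {i : I | inO v (p - x i)}.ncard + 3 * c ≤ k := by
  have hfin := ht.finC p
  set F : Finset I := hfin.toFinset with hF
  have hmem : ∀ i, i ∈ F ↔ inC v (p - x i) := fun i => by simp [hF]
  have hcard : ∀ Q : Pt → Prop, (∀ q, Q q → inC v q) →
      {i : I | Q (p - x i)}.ncard = ∑ i ∈ F, if Q (p - x i) then 1 else 0 := by
    intro Q hQ
    rw [← Finset.card_filter, ← Set.ncard_coe_finset]
    congr 1
    ext i
    simp only [mem_ofPred_eq, Finset.coe_filter, hmem]
    exact ⟨fun h => ⟨hQ _ h, h⟩, fun h => h.2⟩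
  have hvC : ∀ n, inC v (v n) := fun n s => hv.min s n
  have hA : ∀ j, {i : I | p - x i = v j ∨ p - x i = v (j + 7)}.ncard =
      ∑ i ∈ F, if p - x i = v j ∨ p - x i = v (j + 7) then 1 else 0 := by
    intro j
    convert hcard (fun q => q = v j ∨ q = v (j + 7)) (by rintro q (rfl | rfl) <;> exact hvC _)
  have hT : ∀ u, (∀ s, yy v s u ≠ 0) → (∑ i ∈ F, if inT v u (p - x i) then 1 else 0) = k := by
    intro u hu
    rw [← hcard (fun q => inT v u q) (fun q h => inT_C h)]
    have := ht.countT hv p u hu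
    rw [Set.ncard, this]; rfl
  have hmain : ∀ j, 2 * k + {i : I | p - x i = v j ∨ p - x i = v (j + 7)}.ncard =
      ∑ i ∈ F, if inO v (p - x i) then 2 else 1 := by
    intro j
    rw [hA, ← Finset.sum_congr rfl (fun i hi => hv.weight j (p - x i) ((hmem i).1 hi)),
      Finset.sum_add_distrib, Finset.sum_add_distrib, hT _ (hv.dir_ne j), hT]
    · ring
    · intro s
      have := hv.dir_ne j s
      unfold yy at this ⊢
      rw [dt_neg]
      exact neg_ne_zero.2 this
  set c := {i : I | p - x i = v 0 ∨ p - x i = v (0 + 7)}.ncard with hc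
  have hconst : ∀ j, {i : I | p - x i = v j ∨ p - x i = v (j + 7)}.ncard = c := by
    intro j
    have h1 := hmain j
    have h2 := hmain 0
    omega
  refine ⟨c, hconst, ?_⟩
  have h2 := hmain 0
  rw [hcard (fun q => inO v q) (fun q h => inO_C h)]
  have h7 : ∑ j ∈ Finset.Ico (0 : ℤ) 7, ∑ i ∈ F,
      (if p - x i = v j ∨ p - x i = v (j + 7) then 1 else 0) = 7 * c := by
    rw [Finset.sum_congr rfl (fun j _ => (hA j).symm.trans (hconst j))]
    simp
  rw [Finset.sum_comm] at h7
  have hle : ∀ i ∈ F, (∑ j ∈ Finset.Ico (0 : ℤ) 7,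
      (if p - x i = v j ∨ p - x i = v (j + 7) then 1 else 0)) + 2 * (if inO v (p - x i) then 1 else 0)
      ≤ if inO v (p - x i) then 2 else 1 := by
    intro i _
    by_cases hO : inO v (p - x i)
    · have h2 : ∀ n, p - x i ≠ v n := by
        intro n h
        rw [h] at hO
        exact lt_irrefl _ (hO n)
      simp [hO, h2]
    · simp only [hO, if_false, mul_zero, add_zero]
      rw [← Finset.card_filter]
      apply Finset.card_le_one.2
      intro a ha b hb
      simp only [Finset.mem_filter, Finset.mem_Ico] at ha hb
      by_contra hab
      have key : ∀ a b : ℤ, 0 ≤ a → a < 14 → 0 ≤ b → b < 14 → p - x i = v a → p - x i = v b → a = b := by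
        intro a b h1 h2 h3 h4 h5 h6
        rcases lt_trichotomy a b with c | c | c
        · exact (hv.inj a b c (by omega) (h5.symm.trans h6)).elim
        · exact c
        · exact (hv.inj b a c (by omega) (h6.symm.trans h5)).elim
      obtain ⟨⟨a1, a2⟩, a3 | a3⟩ := ha <;> obtain ⟨⟨b1, b2⟩, b3 | b3⟩ := hb <;>
      · have := key _ _ (by omega) (by omega) (by omega) (by omega) a3 b3
        omega
  have := Finset.sum_le_sum hle
  rw [Finset.sum_add_distrib, h7, ← Finset.mul_sum] at this
  omega

end locsum
/-! ### Seven vertices in the interior of each tile -/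

/-- The pairs produced by a sign pattern. -/
def patt (σ : Fin 6 → Bool) : Finset (Fin 6 × Fin 6) :=
  Finset.univ.filter (fun z => z.1 < z.2 ∧ (σ z.1 = true ∨ σ z.2 = false))

/-- The extremal set of pairs. -/
def patt0 : Finset (Fin 6 × Fin 6) := {(0, 1), (0, 2), (1, 2), (3, 4), (3, 5), (4, 5)}

theorem patt_dec : ∀ b0 b1 b2 b3 b4 b5 : Bool,
    7 ≤ (patt ![b0, b1, b2, b3, b4, b5]).card ∨ patt ![b0, b1, b2, b3, b4, b5] = patt0 := by
  decide +kernel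

theorem patt_cases (σ : Fin 6 → Bool) : 7 ≤ (patt σ).card ∨ patt σ = patt0 := by
  have h : σ = ![σ 0, σ 1, σ 2, σ 3, σ 4, σ 5] := by
    ext i; fin_cases i <;> rfl
  rw [h]; exact patt_dec _ _ _ _ _ _

/-- The candidate interior points seen from the vertex `i`. -/
def cpt (v : ℤ → Pt) (i : ℤ) (z : Fin 6 × Fin 6) : Pt :=
  v i + (v (i + 1 + (z.2 : ℕ)) - v (i + 1 + (z.1 : ℕ)))

section seven
variable {v : ℤ → Pt} (hv : Gon v) {I : Type} {x : I → Pt} {k : ℕ} {ρ : ℝ} (ht : Til v x k ρ)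
include hv

theorem Gon.cpt_inj (i : ℤ) (S : Finset (Fin 6 × Fin 6)) (hS : ∀ z ∈ S, z.1 < z.2) :
    Set.InjOn (cpt v i) S := by
  intro z hz z' hz' h
  have h1 := hS z hz
  have h2 := hS z' hz'
  have b1 := z.1.2
  have b2 := z.2.2
  have b3 := z'.1.2
  have b4 := z'.2.2
  rw [Fin.lt_def] at h1 h2
  have h := add_left_cancel h
  have := hv.pair_inj i _ _ _ _ (by omega) (by omega) (by omega) (by omega) (by omega) (by omega) h
  ext <;> omega

theorem Gon.cpt_O (i : ℤ) (z : Fin 6 × Fin 6) (hz : z.1 < z.2) : inO v (cpt v i z) := by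
  have b2 := z.2.2
  rw [Fin.lt_def] at hz
  exact hv.interior i _ _ (by omega) (by omega) (by omega)

include ht

theorem Til.partner (i0 : I) (i l : ℤ) :
    ∃ i', x i0 + v i - x i' = v l ∨ x i0 + v i - x i' = v (l + 7) := by
  obtain ⟨c, hc, _⟩ := ht.local_count hv (x i0 + v i)
  have hfin : ∀ j, {i' : I | x i0 + v i - x i' = v j ∨ x i0 + v i - x i' = v (j + 7)}.Finite := by
    intro j
    refine (ht.finC (x i0 + v i)).subset ?_
    rintro i' (h | h)
    · show inC v _
      rw [h]; exact fun s => hv.min s _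
    · show inC v _
      rw [h]; exact fun s => hv.min s _
  have h1 : c ≠ 0 := by
    rw [← hc i]
    intro h
    rw [Set.ncard_eq_zero (hfin i)] at h
    have : i0 ∈ (∅ : Set I) := by
      rw [← h]; left; abel
    exact this
  have h2 := hc l
  have : {i' : I | x i0 + v i - x i' = v l ∨ x i0 + v i - x i' = v (l + 7)}.Nonempty := by
    apply Set.nonempty_of_ncard_ne_zero
    rw [h2]; exact h1
  exact this

theorem Til.pattern (i0 : I) (i : ℤ) : ∃ σ : Fin 6 → Bool, ∀ z ∈ patt σ,
    inO v (cpt v i z) ∧ ∃ i' n, x i0 + cpt v i z - x i' = v n := by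
  classical
  refine ⟨fun a => decide (∃ i', x i0 + v i - x i' = v (i + 1 + (a : ℕ))), ?_⟩
  intro z hz
  simp only [patt, Finset.mem_filter, Finset.mem_univ, true_and, decide_eq_true_eq,
    decide_eq_false_iff_not] at hz
  obtain ⟨hz, h⟩ := hz
  refine ⟨hv.cpt_O i z hz, ?_⟩
  rcases h with ⟨i', h⟩ | h
  · refine ⟨i', i + 1 + (z.2 : ℕ), ?_⟩
    unfold cpt
    rw [← h]; abel
  · obtain ⟨i', h' | h'⟩ := ht.partner hv i0 i (i + 1 + (z.2 : ℕ))
    · exact (h ⟨i', h'⟩).elim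
    · refine ⟨i', i + 1 + (z.1 : ℕ) + 7, ?_⟩
      rw [hv.anti] at h' ⊢
      unfold cpt
      have : x i0 + v i - x i' + v (i + 1 + (z.2 : ℕ)) = 0 := by rw [h']; abel
      rw [← sub_eq_zero, ← this]; abel

theorem Til.seven (i0 : I) : ∃ W : Finset Pt, 7 ≤ W.card ∧ ∀ q ∈ W,
    inO v q ∧ ∃ i' n, x i0 + q - x i' = v n := by
  classical
  have hlt : ∀ σ, ∀ z ∈ patt σ, z.1 < z.2 := by
    intro σ z hz
    simp only [patt, Finset.mem_filter] at hz
    exact hz.2.1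
  have himg : ∀ i, ∃ W : Finset Pt, (∀ q ∈ W, inO v q ∧ ∃ i' n, x i0 + q - x i' = v n) ∧
      (7 ≤ W.card ∨ W = patt0.image (cpt v i)) := by
    intro i
    obtain ⟨σ, hσ⟩ := ht.pattern hv i0 i
    refine ⟨(patt σ).image (cpt v i), ?_, ?_⟩
    · intro q hq
      obtain ⟨z, hz, rfl⟩ := Finset.mem_image.1 hq
      exact hσ z hz
    · rw [Finset.card_image_of_injOn (hv.cpt_inj i _ (hlt σ))]
      rcases patt_cases σ with h | h
      · exact Or.inl h
      · right; rw [h]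
  have hp0 : ∀ z ∈ patt0, z.1 < z.2 := by decide
  have hc0 : patt0.card = 6 := by decide
  obtain ⟨W0, hW0, h0⟩ := himg 0
  obtain ⟨W7, hW7, h7⟩ := himg 7
  rcases h0 with h0 | h0
  · exact ⟨W0, h0, hW0⟩
  rcases h7 with h7 | h7
  · exact ⟨W7, h7, hW7⟩
  refine ⟨W0 ∪ W7, ?_, ?_⟩
  · by_contra hcard
    have c0 : W0.card = 6 := by
      rw [h0, Finset.card_image_of_injOn (hv.cpt_inj 0 _ hp0), hc0]
    have c7 : W7.card = 6 := by
      rw [h7, Finset.card_image_of_injOn (hv.cpt_inj 7 _ hp0), hc0]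
    have e0 : W0 = W0 ∪ W7 := Finset.eq_of_subset_of_card_le Finset.subset_union_left (by omega)
    have e7 : W7 = W0 ∪ W7 := Finset.eq_of_subset_of_card_le Finset.subset_union_right (by omega)
    have e : W0 = W7 := e0.trans e7.symm
    have hs : ∑ q ∈ W0, yy v 0 q = ∑ q ∈ W7, yy v 0 q := by rw [e]
    rw [h0, h7, Finset.sum_image (hv.cpt_inj 0 _ hp0), Finset.sum_image (hv.cpt_inj 7 _ hp0)] at hs
    have hy : ∀ i z, yy v 0 (cpt v i z) = yy v 0 (v i) +
        (yy v 0 (v (i + 1 + (z.2 : ℕ))) - yy v 0 (v (i + 1 + (z.1 : ℕ)))) := by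
      intro i z; unfold cpt yy; rw [dt_add, dt_sub]
    have hneg : ∀ z, yy v 0 (cpt v 7 z) = - yy v 0 (cpt v 0 z) := by
      intro z
      rw [hy, hy]
      have a1 := hv.f7 0 0
      have a2 := hv.f7 0 (0 + 1 + (z.2 : ℕ))
      have a3 := hv.f7 0 (0 + 1 + (z.1 : ℕ))
      rw [show (7 : ℤ) + 1 + (z.2 : ℕ) = 0 + 1 + (z.2 : ℕ) + 7 by ring,
        show (7 : ℤ) + 1 + (z.1 : ℕ) = 0 + 1 + (z.1 : ℕ) + 7 by ring, a2, a3]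
      rw [show (7 : ℤ) = 0 + 7 by ring, a1]; ring
    simp only [hneg, Finset.sum_neg_distrib] at hs
    have hz : ∑ z ∈ patt0, yy v 0 (cpt v 0 z) = 0 := by linarith
    simp only [hy] at hz
    unfold patt0 at hz
    rw [Finset.sum_insert (by decide), Finset.sum_insert (by decide), Finset.sum_insert (by decide),
      Finset.sum_insert (by decide), Finset.sum_insert (by decide), Finset.sum_singleton] at hz
    norm_num at hz
    have r1 := hv.rise 0 3 4 (by omega) (by omega) (by omega)
    have r2 := hv.max 0 6
    have r3 := yself (v := v) 0
    have r4 := hv.mneg 0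
    norm_num at r3
    linarith
  · intro q hq
    rcases Finset.mem_union.1 hq with h | h
    · exact hW0 q h
    · exact hW7 q h

end seven

/-! ### Global counting -/

section glob
variable {v : ℤ → Pt} (hv : Gon v) {I : Type} {x : I → Pt} {k : ℕ} {ρ : ℝ} (ht : Til v x k ρ)
include hv ht

theorem Til.growth (hk : k ≤ 6) (R : ℝ) :
    7 * (ht.disc R).toFinset.card ≤ 6 * (ht.disc (R + 2 * ρ)).toFinset.card := by
  classical
  set A := (ht.disc R).toFinset with hA
  set B := (ht.disc (R + 2 * ρ)).toFinset with hB
  have hvC : ∀ n, inC v (v n) := fun n s => hv.min s n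
  -- the vertices
  let V : Finset Pt := ((B ×ˢ Finset.Ico (0 : ℤ) 14).image (fun z => x z.1 + v z.2)).filter
    (fun p => ‖p‖ ≤ R + ρ)
  have hV : ∀ p i n, ‖p‖ ≤ R + ρ → p - x i = v n → p ∈ V := by
    intro p i n hp h
    refine Finset.mem_filter.2 ⟨Finset.mem_image.2 ?_, hp⟩
    obtain ⟨m, r, rfl, h4, h5⟩ := mod14 0 n
    rw [hv.v14] at h
    refine ⟨(i, r), Finset.mem_product.2 ⟨?_, Finset.mem_Ico.2 ⟨h4, by simpa using h5⟩⟩, ?_⟩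
    · simp only [hB, Set.Finite.mem_toFinset, mem_ofPred_eq]
      have h1 := ht.bdd _ (hvC r)
      have : x i = p - v r := by rw [← h]; abel
      rw [this]
      calc ‖p - v r‖ ≤ ‖p‖ + ‖v r‖ := norm_sub_le _ _
        _ ≤ R + 2 * ρ := by linarith
    · show x i + v r = p
      rw [← h]; abel
  have hV' : ∀ p ∈ V, ‖p‖ ≤ R + ρ ∧ ∃ i n, p - x i = v n := by
    intro p hp
    obtain ⟨h1, h2⟩ := Finset.mem_filter.1 hp
    obtain ⟨z, _, rfl⟩ := Finset.mem_image.1 h1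
    exact ⟨h2, z.1, z.2, by abel⟩
  -- lower bound
  have hlow : 7 * A.card ≤ ∑ i ∈ A, (Finset.bipartiteAbove (fun i p => inO v (p - x i)) V i).card := by
    rw [mul_comm, ← smul_eq_mul]
    apply Finset.card_nsmul_le_sum
    intro i hi
    obtain ⟨W, hW, hWq⟩ := ht.seven hv i
    refine hW.trans ?_
    rw [← Finset.card_image_of_injective W (add_right_injective (x i))]
    apply Finset.card_le_card
    intro p hp
    obtain ⟨q, hq, rfl⟩ := Finset.mem_image.1 hp
    obtain ⟨hO, i', n, hn⟩ := hWq q hq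
    rw [Finset.mem_bipartiteAbove]
    constructor
    · refine hV _ i' n ?_ hn
      have h1 := ht.bdd _ (inO_C hO)
      have h2 : ‖x i‖ ≤ R := by simpa [hA] using hi
      calc ‖x i + q‖ ≤ ‖x i‖ + ‖q‖ := norm_add_le _ _
        _ ≤ R + ρ := by linarith
    · show inO v (x i + q - x i)
      rwa [add_sub_cancel_left]
  rw [Finset.sum_card_bipartiteAbove_eq_sum_card_bipartiteBelow] at hlow
  -- local bound
  have hloc : ∀ p ∈ V, (Finset.bipartiteBelow (fun i p => inO v (p - x i)) A p).card ≤
      3 * (Finset.bipartiteBelow (fun i p => p - x i = v 0 ∨ p - x i = v (0 + 7)) B p).card := by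
    intro p hp
    obtain ⟨hpn, i, n, hin⟩ := hV' p hp
    obtain ⟨c, hc, hle⟩ := ht.local_count hv p
    have hsub : ∀ j, {i : I | p - x i = v j ∨ p - x i = v (j + 7)} ⊆ B := by
      intro j i hi
      simp only [hB, Set.Finite.coe_toFinset, mem_ofPred_eq]
      have h1 : ‖p - x i‖ ≤ ρ := by
        apply ht.bdd
        rcases hi with h | h
        · rw [h]; exact hvC _
        · rw [h]; exact hvC _
      have : x i = p - (p - x i) := by abel
      calc ‖x i‖ = ‖p - (p - x i)‖ := by rw [← this]
        _ ≤ ‖p‖ + ‖p - x i‖ := norm_sub_le _ _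
        _ ≤ R + 2 * ρ := by linarith
    have hc1 : 1 ≤ c := by
      rw [← hc n]
      apply Nat.one_le_iff_ne_zero.2
      exact Set.ncard_ne_zero_of_mem (a := i) (Or.inl hin) (B.finite_toSet.subset (hsub n))
    have e1 : (Finset.bipartiteBelow (fun i p => p - x i = v 0 ∨ p - x i = v (0 + 7)) B p).card = c := by
      rw [← hc 0, ← Set.ncard_coe_finset]
      congr 1
      ext i
      simp only [Finset.bipartiteBelow, Finset.coe_filter, mem_ofPred_eq]
      exact ⟨fun h => h.2, fun h => ⟨hsub 0 h, h⟩⟩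
    have e2 : (Finset.bipartiteBelow (fun i p => inO v (p - x i)) A p).card ≤
        {i : I | inO v (p - x i)}.ncard := by
      rw [← Set.ncard_coe_finset]
      apply Set.ncard_le_ncard
      · intro i hi
        simp only [Finset.bipartiteBelow, Finset.coe_filter, mem_ofPred_eq] at hi
        exact hi.2
      · exact (ht.finC p).subset (fun i hi => inO_C hi)
    omega
  have h2 := Finset.sum_le_sum hloc
  rw [← Finset.mul_sum, ← Finset.sum_card_bipartiteAbove_eq_sum_card_bipartiteBelow
    (s := B) (fun i p => p - x i = v 0 ∨ p - x i = v (0 + 7))] at h2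
  have h3 : ∑ i ∈ B, (Finset.bipartiteAbove (fun i p => p - x i = v 0 ∨ p - x i = v (0 + 7)) V i).card
      ≤ B.card * 2 := by
    rw [← smul_eq_mul]
    apply Finset.sum_le_card_nsmul
    intro i _
    refine le_trans (Finset.card_le_card (t := {x i + v 0, x i + v (0 + 7)}) ?_) Finset.card_le_two
    intro p hp
    rw [Finset.mem_bipartiteAbove] at hp
    rcases hp.2 with h | h
    · rw [← h]; simp
    · rw [← h]; simp
  omega

theorem Til.false (hk0 : 0 < k) (hk : k ≤ 6) {δ : ℝ} (hδ : 0 < δ)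
    (hball : ∀ q : Pt, ‖q‖ ≤ δ → inO v q) : False := by
  classical
  -- packing bound in a grid
  have hpoly : ∀ N : ℕ, (ht.disc (N * δ)).toFinset.card ≤ k * (2 * N + 1) ^ 2 := by
    intro N
    let g : I → ℤ × ℤ := fun i => (⌊(x i).1 / δ⌋, ⌊(x i).2 / δ⌋)
    have hmaps : ∀ i ∈ (ht.disc (N * δ)).toFinset, g i ∈ Finset.Icc (-(N : ℤ)) N ×ˢ Finset.Icc (-(N : ℤ)) N := by
      intro i hi
      have hi : ‖x i‖ ≤ N * δ := by simpa using hi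
      have key : ∀ a : ℝ, |a| ≤ N * δ → ⌊a / δ⌋ ∈ Finset.Icc (-(N : ℤ)) N := by
        intro a ha
        rw [abs_le] at ha
        rw [Finset.mem_Icc]
        constructor
        · rw [Int.le_floor, le_div_iff₀ hδ]; push_cast; linarith
        · have : (⌊a / δ⌋ : ℝ) ≤ N := (Int.floor_le _).trans (by rw [div_le_iff₀ hδ]; linarith)
          exact_mod_cast this
      exact Finset.mem_product.2 ⟨key _ ((norm_fst_le (x i)).trans hi),
        key _ ((norm_snd_le (x i)).trans hi)⟩
    have hfib : ∀ b ∈ Finset.Icc (-(N : ℤ)) N ×ˢ Finset.Icc (-(N : ℤ)) N,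
        ((ht.disc (N * δ)).toFinset.filter (fun i => g i = b)).card ≤ k := by
      intro b _
      have hp := ht.pack ((b.1 : ℝ) * δ, (b.2 : ℝ) * δ)
      have : (((ht.disc (N * δ)).toFinset.filter (fun i => g i = b) : Finset I) : Set I).encard ≤ k := by
        refine le_trans (encard_le_encard ?_) hp
        intro i hi
        have hi : g i = b := by
          simp only [Finset.coe_filter, mem_ofPred_eq] at hi
          exact hi.2
        apply hball
        have key : ∀ a : ℝ, |(⌊a / δ⌋ : ℝ) * δ - a| ≤ δ := by
          intro a
          have h1 := Int.floor_le (a / δ)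
          have h2 := Int.lt_floor_add_one (a / δ)
          rw [le_div_iff₀ hδ] at h1
          rw [div_lt_iff₀ hδ] at h2
          rw [abs_le]; constructor <;> linarith
        rw [← hi, Prod.norm_def]
        exact max_le (key _) (key _)
      rw [Set.encard_coe_eq_coe_finsetCard] at this
      exact_mod_cast this
    have := Finset.card_le_mul_card_image_of_maps_to hmaps k hfib
    rw [Finset.card_product, Int.card_Icc] at this
    have e : ((N : ℤ) + 1 - -(N : ℤ)).toNat = 2 * N + 1 := by omega
    rw [e] at this
    rw [pow_two]; exact this
  -- a tile
  obtain ⟨i0⟩ : Nonempty I := by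
    by_contra h
    rw [not_nonempty_iff] at h
    have := ht.cov 0
    rw [Set.eq_empty_of_isEmpty {i : I | inC v (0 - x i)}, Set.encard_empty] at this
    simp at this
    omega
  obtain ⟨M, hM⟩ := exists_nat_ge ((2 * |ρ| + ‖x i0‖) / δ)
  rw [div_le_iff₀ hδ] at hM
  let a : ℕ → ℕ := fun n => (ht.disc ((M * (n + 1) : ℕ) * δ)).toFinset.card
  have hmono : ∀ R R', R ≤ R' → (ht.disc R).toFinset.card ≤ (ht.disc R').toFinset.card := by
    intro R R' h
    apply Finset.card_le_card
    intro i hi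
    simp only [Set.Finite.mem_toFinset, mem_ofPred_eq] at hi ⊢
    linarith
  have hρ := le_abs_self ρ
  have hx := norm_nonneg (x i0)
  have hρ0 := abs_nonneg ρ
  have ha0 : 1 ≤ a 0 := by
    apply Finset.card_pos.2
    refine ⟨i0, ?_⟩
    simp only [Set.Finite.mem_toFinset, mem_ofPred_eq]
    push_cast
    linarith
  have hstep : ∀ n, 7 * a n ≤ 6 * a (n + 1) := by
    intro n
    refine (ht.growth hv hk _).trans (Nat.mul_le_mul_left _ (hmono _ _ ?_))
    push_cast
    nlinarith
  have hexp : ∀ n, ((7 : ℝ) / 6) ^ n ≤ a n := by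
    intro n
    induction n with
    | zero => simpa using ha0
    | succ n ih =>
      have : (7 : ℝ) * a n ≤ 6 * a (n + 1) := by exact_mod_cast hstep n
      rw [pow_succ]; linarith
  have hub : ∀ n, (a n : ℝ) ≤ k * (2 * M + 1) ^ 2 * ((n : ℝ) + 1) ^ 2 := by
    intro n
    have h1 : (a n : ℝ) ≤ (k * (2 * (M * (n + 1)) + 1) ^ 2 : ℕ) := by exact_mod_cast hpoly (M * (n + 1))
    refine h1.trans ?_
    push_cast
    rw [mul_assoc, ← mul_pow]
    gcongr
    nlinarith [(Nat.cast_nonneg n : (0 : ℝ) ≤ n)]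
  have hlim := tendsto_pow_const_div_const_pow_of_one_lt 2 (show (1 : ℝ) < 7 / 6 by norm_num)
  have hC : (0 : ℝ) < k * (2 * M + 1) ^ 2 := by positivity
  set C : ℝ := k * (2 * M + 1) ^ 2 with hCdef
  have hev := hlim.eventually (gt_mem_nhds (show (0 : ℝ) < 1 / (2 * C) by positivity))
  obtain ⟨n, hn, hn1⟩ := (hev.and (Filter.eventually_ge_atTop 1)).exists
  obtain ⟨m, rfl⟩ : ∃ m, n = m + 1 := ⟨n - 1, by omega⟩
  have h1 := (hexp m).trans (hub m)
  have hpos : (0 : ℝ) < (7 / 6) ^ (m + 1) := by positivity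
  rw [div_lt_div_iff₀ hpos (by positivity)] at hn
  rw [pow_succ (7 / 6 : ℝ)] at hn
  push_cast at hn
  have h3 : (0 : ℝ) < (7 / 6) ^ m := by positivity
  nlinarith

end glob
/-! ### Geometry: from the polygon to the vertex system -/

theorem comb_mem {P : Set Pt} (hc : Convex ℝ P) (h0 : (0 : Pt) ∈ P) {a b : Pt} (ha : a ∈ P) (hb : b ∈ P)
    {α β : ℝ} (hα : 0 ≤ α) (hβ : 0 ≤ β) (h : α + β ≤ 1) : α • a + β • b ∈ P := by
  rcases eq_or_lt_of_le (add_nonneg hα hβ) with e | e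
  · have e1 : α = 0 := by linarith
    have e2 : β = 0 := by linarith
    simpa [e1, e2] using h0
  · have h1 : (α / (α + β)) • a + (β / (α + β)) • b ∈ P :=
      hc ha hb (by positivity) (by positivity) (by field_simp)
    have h2 := hc h1 h0 (a := α + β) (b := 1 - (α + β)) e.le (by linarith) (by ring)
    rw [smul_zero, add_zero, smul_add, smul_smul, smul_smul, mul_div_cancel₀ _ e.ne',
      mul_div_cancel₀ _ e.ne'] at h2
    exact h2

/-- upper half plane -/
def up (p : Pt) : Prop := 0 < p.2 ∨ (p.2 = 0 ∧ 0 < p.1)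

theorem up_neg {p : Pt} (hp : p ≠ 0) : up (-p) ↔ ¬ up p := by
  unfold up
  simp only [Prod.fst_neg, Prod.snd_neg]
  rcases lt_trichotomy p.2 0 with h | h | h
  · have h1 : 0 < -p.2 := by linarith
    have h2 : ¬ 0 < p.2 := by linarith
    simp [h1, h2, h.ne]
  · have h1 : p.1 ≠ 0 := fun h1 => hp (Prod.ext h1 h)
    simp only [h, lt_irrefl, neg_zero, true_and, false_or]
    constructor
    · intro h2; linarith
    · intro h2
      have : p.1 < 0 := lt_of_le_of_ne (not_lt.mp h2) h1
      linarith
  · have h1 : ¬ 0 < -p.2 := by linarith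
    simp [h1, h, h.ne']

theorem dt_anti (p q : Pt) : dt q p = - dt p q := by unfold dt; ring

theorem up_trans {p q r : Pt} (hp : up p) (hq : up q) (hr : up r) (h1 : 0 < dt p q) (h2 : 0 < dt q r) :
    0 < dt p r := by
  have hid : dt p r * q.2 = dt p q * r.2 + dt q r * p.2 := by unfold dt; ring
  rcases hq with hq | ⟨hq, hq1⟩
  · have hr0 : 0 ≤ r.2 := by rcases hr with h | h <;> linarith [h]
    have hp0 : 0 ≤ p.2 := by rcases hp with h | h <;> linarith [h]
    have hpos : 0 < dt p q * r.2 + dt q r * p.2 := by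
      rcases hp with hp | ⟨hp, hp1⟩
      · have := mul_pos h2 hp
        have := mul_nonneg h1.le hr0
        linarith
      · rcases hr with hr | ⟨hr, hr1⟩
        · have := mul_pos h1 hr
          have := mul_nonneg h2.le hp0
          linarith
        · unfold dt at h2
          rw [hr] at h2
          have := mul_pos hq hr1
          linarith
    rw [← hid] at hpos
    by_contra hc
    nlinarith
  · unfold dt at h1
    rw [hq] at h1
    have hp0 : 0 ≤ p.2 := by rcases hp with h | h <;> linarith [h]
    have := mul_nonneg hp0 hq1.le
    linarith

theorem up_ray {p q : Pt} (hp : up p) (hq : up q) (h : dt p q = 0) : ∃ t : ℝ, 0 < t ∧ q = t • p := by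
  unfold dt at h
  rcases hp with hp | ⟨hp, hp1⟩
  · have hq2 : 0 < q.2 := by
      rcases hq with hq | ⟨hq, hq1⟩
      · exact hq
      · rw [hq] at h
        have := mul_pos hp hq1
        linarith
    refine ⟨q.2 / p.2, by positivity, Prod.ext ?_ ?_⟩
    · simp; field_simp; linarith
    · simp; field_simp
  · rw [hp] at h
    have hq2 : q.2 = 0 := by
      have : p.1 * q.2 = 0 := by linarith
      rcases mul_eq_zero.1 this with h | h
      · linarith
      · exact h
    have hq1 : 0 < q.1 := by
      rcases hq with hq | ⟨_, hq⟩
      · linarith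
      · exact hq
    refine ⟨q.1 / p.1, by positivity, Prod.ext ?_ ?_⟩
    · simp; field_simp
    · simp [hp, hq2]

/-- A cyclic enumeration of a symmetric set of fourteen extreme points. -/
theorem sorted_enum (E : Finset Pt) (hcard : E.card = 14) (h0 : (0 : Pt) ∉ E)
    (hs : ∀ p ∈ E, -p ∈ E) (hray : ∀ p ∈ E, ∀ t : ℝ, 0 < t → t • p ∈ E → t • p = p) :
    ∃ v : ℤ → Pt, (∀ i, v (i + 7) = - v i) ∧ (∀ i, v i ∈ E) ∧ (∀ p ∈ E, ∃ i, p = v i) ∧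
      ∀ i j, i < j → j < i + 7 → 0 < dt (v i) (v j) := by
  classical
  set H := E.filter up with hH
  have hHE : ∀ p ∈ H, p ∈ E := fun p hp => (Finset.mem_filter.1 hp).1
  have hHu : ∀ p ∈ H, up p := fun p hp => (Finset.mem_filter.1 hp).2
  have hne : ∀ p ∈ E, p ≠ 0 := fun p hp h => h0 (h ▸ hp)
  have hHc : H.card = 7 := by
    have h1 := Finset.card_filter_add_card_filter_not (s := E) up
    have h2 : E.filter (fun p => ¬ up p) = H.image (fun p => -p) := by
      ext p
      simp only [Finset.mem_filter, Finset.mem_image, hH]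
      constructor
      · rintro ⟨hp, hu⟩
        exact ⟨-p, ⟨hs p hp, (up_neg (hne p hp)).2 hu⟩, neg_neg p⟩
      · rintro ⟨q, ⟨hq, hu⟩, rfl⟩
        refine ⟨hs q hq, ?_⟩
        have := up_neg (hne q hq)
        tauto
    rw [h2, Finset.card_image_of_injective _ neg_injective, hcard, ← hH] at h1
    omega
  have hdet : ∀ p ∈ H, ∀ q ∈ H, dt p q = 0 → p = q := by
    intro p hp q hq h
    obtain ⟨t, ht, rfl⟩ := up_ray (hHu p hp) (hHu q hq) h
    exact (hray p (hHE p hp) t ht (hHE _ hq)).symm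
  let rk : Pt → ℕ := fun p => (H.filter (fun q => 0 < dt q p)).card
  have hself : ∀ p, dt p p = 0 := fun p => by unfold dt; ring
  have hrk : ∀ p ∈ H, ∀ q ∈ H, 0 < dt p q → rk p < rk q := by
    intro p hp q hq h
    apply Finset.card_lt_card
    rw [Finset.ssubset_iff_of_subset]
    · refine ⟨p, Finset.mem_filter.2 ⟨hp, h⟩, ?_⟩
      intro h'
      have := (Finset.mem_filter.1 h').2
      rw [hself] at this
      exact lt_irrefl _ this
    · intro r hr
      obtain ⟨hr, hr'⟩ := Finset.mem_filter.1 hr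
      exact Finset.mem_filter.2 ⟨hr, up_trans (hHu r hr) (hHu p hp) (hHu q hq) hr' h⟩
  have hinj : ∀ p ∈ H, ∀ q ∈ H, rk p = rk q → p = q := by
    intro p hp q hq h
    rcases lt_trichotomy (dt p q) 0 with c | c | c
    · have := hrk q hq p hp (by rw [dt_anti]; linarith)
      omega
    · exact hdet p hp q hq c
    · have := hrk p hp q hq c
      omega
  have hlt : ∀ p ∈ H, rk p < 7 := by
    intro p hp
    rw [← hHc]
    apply Finset.card_lt_card
    rw [Finset.ssubset_iff_of_subset (Finset.filter_subset _ _)]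
    refine ⟨p, hp, ?_⟩
    intro h'
    have := (Finset.mem_filter.1 h').2
    rw [hself] at this
    exact lt_irrefl _ this
  have himg : H.image rk = Finset.range 7 := by
    apply Finset.eq_of_subset_of_card_le
    · intro n hn
      obtain ⟨p, hp, rfl⟩ := Finset.mem_image.1 hn
      exact Finset.mem_range.2 (hlt p hp)
    · rw [Finset.card_image_of_injOn (fun p hp q hq h => hinj p hp q hq h), hHc]; simp
  have hex : ∀ n : ℕ, ∃ p, n < 7 → p ∈ H ∧ rk p = n := by
    intro n
    by_cases hn : n < 7
    · have : n ∈ H.image rk := by rw [himg]; exact Finset.mem_range.2 hn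
      obtain ⟨p, hp, h⟩ := Finset.mem_image.1 this
      exact ⟨p, fun _ => ⟨hp, h⟩⟩
    · exact ⟨0, fun h => (hn h).elim⟩
  choose w hw using hex
  have hwd : ∀ m n : ℕ, m < n → n < 7 → 0 < dt (w m) (w n) := by
    intro m n h1 h2
    obtain ⟨hm, hm'⟩ := hw m (by omega)
    obtain ⟨hn, hn'⟩ := hw n h2
    rcases lt_trichotomy (dt (w m) (w n)) 0 with c | c | c
    · have := hrk _ hn _ hm (by rw [dt_anti]; linarith)
      omega
    · have := hdet _ hm _ hn c
      rw [this] at hm'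
      omega
    · exact c
  let v : ℤ → Pt := fun n => if Even (n / 7) then w (n % 7).toNat else - w (n % 7).toNat
  have hv7 : ∀ i, v (i + 7) = - v i := by
    intro i
    have e1 : (i + 7) / 7 = i / 7 + 1 := by omega
    have e2 : (i + 7) % 7 = i % 7 := by omega
    simp only [v, e1, e2, Int.even_add_one]
    by_cases h : Even (i / 7) <;> simp [h]
  have hwE : ∀ i : ℤ, w (i % 7).toNat ∈ E := fun i => hHE _ (hw _ (by omega)).1
  refine ⟨v, hv7, ?_, ?_, ?_⟩
  · intro i
    simp only [v]
    split_ifs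
    · exact hwE i
    · exact hs _ (hwE i)
  · have hup : ∀ p ∈ H, p = v (rk p) := by
      intro p hp
      have h7 := hlt p hp
      have e1 : ((rk p : ℕ) : ℤ) / 7 = 0 := by omega
      have e2 : (((rk p : ℕ) : ℤ) % 7).toNat = rk p := by omega
      simp only [v, e1, e2, Even.zero, if_true]
      obtain ⟨h1, h2⟩ := hw (rk p) h7
      exact hinj p hp _ h1 h2.symm
    intro p hp
    by_cases hu : up p
    · exact ⟨_, hup p (Finset.mem_filter.2 ⟨hp, hu⟩)⟩
    · have := hup (-p) (Finset.mem_filter.2 ⟨hs p hp, (up_neg (hne p hp)).2 hu⟩)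
      refine ⟨rk (-p) + 7, ?_⟩
      rw [hv7, ← this, neg_neg]
  · intro i j h1 h2
    by_cases c : j / 7 = i / 7
    · have := hwd (i % 7).toNat (j % 7).toNat (by omega) (by omega)
      simp only [v, c]
      split_ifs
      · exact this
      · unfold dt at this ⊢
        simp only [Prod.fst_neg, Prod.snd_neg]
        linarith
    · have c : j / 7 = i / 7 + 1 := by omega
      have := hwd (j % 7).toNat (i % 7).toNat (by omega) (by omega)
      simp only [v, c, Int.even_add_one]
      by_cases h : Even (i / 7)
      · simp only [h, not_true, if_true, if_false]
        unfold dt at this ⊢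
        simp only [Prod.fst_neg, Prod.snd_neg]
        linarith
      · simp only [h, not_false_iff, if_true, if_false]
        unfold dt at this ⊢
        simp only [Prod.fst_neg, Prod.snd_neg]
        linarith

theorem geom (E : Finset Pt) (P : Set Pt) (hconv : Convex ℝ P) (hcard : E.card = 14)
    (hE : ∀ p ∈ E, p ∈ P) (hs : ∀ p ∈ E, -p ∈ E)
    (hN : ∀ p ∈ E, ∀ p1 ∈ P, ∀ p2 ∈ P, ∀ a b : ℝ, 0 < a → 0 < b → a + b = 1 →
      a • p1 + b • p2 = p → p1 = p) :
    ∃ v : ℤ → Pt, Gon v ∧ (∀ p ∈ E, ∃ n, p = v n) ∧ (∀ q, inC v q → q ∈ P) := by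
  have h0P : (0 : Pt) ∈ P := by
    obtain ⟨p, hp⟩ : E.Nonempty := Finset.card_pos.1 (by omega)
    have := hconv (hE p hp) (hE _ (hs p hp)) (a := 1 / 2) (b := 1 / 2) (by norm_num) (by norm_num) (by norm_num)
    simpa using this
  have h0E : (0 : Pt) ∉ E := by
    intro h
    obtain ⟨p, hp, hne⟩ := Finset.exists_mem_ne (by omega : 1 < E.card) (0 : Pt)
    exact hne (hN 0 h p (hE p hp) (-p) (hE _ (hs p hp)) (1 / 2) (1 / 2) (by norm_num) (by norm_num)
      (by norm_num) (by simp))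
  have hray1 : ∀ p ∈ E, ∀ t : ℝ, 0 < t → t < 1 → t • p ∈ E → t • p = p := by
    intro p hp t ht ht1 h
    refine (hN _ h p (hE p hp) (-p) (hE _ (hs p hp)) ((1 + t) / 2) ((1 - t) / 2) (by linarith)
      (by linarith) (by ring) ?_).symm
    rw [smul_neg, ← sub_eq_add_neg, ← sub_smul]
    congr 1; ring
  have hray : ∀ p ∈ E, ∀ t : ℝ, 0 < t → t • p ∈ E → t • p = p := by
    intro p hp t ht h
    rcases lt_trichotomy t 1 with c | c | c
    · exact hray1 p hp t ht c h
    · rw [c, one_smul]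
    · have e : t⁻¹ • (t • p) = p := by rw [smul_smul, inv_mul_cancel₀ ht.ne', one_smul]
      have := hray1 (t • p) h t⁻¹ (by positivity) (inv_lt_one_of_one_lt₀ c) (by rw [e]; exact hp)
      rw [e] at this
      exact this.symm
  obtain ⟨v, hv7, hvE, hvs, hD⟩ := sorted_enum E hcard h0E hs hray
  have hself : ∀ p, dt p p = 0 := fun p => by unfold dt; ring
  have hv14 : ∀ m, v (m + 14) = v m := fun m => by
    rw [show m + 14 = (m + 7) + 7 by ring, hv7, hv7, neg_neg]
  -- coordinates
  have hcoord : ∀ a b q : Pt, dt a b ≠ 0 →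
      q = (dt q b / dt a b) • a + (dt a q / dt a b) • b := by
    intro a b q h
    ext
    · simp only [Prod.fst_add, Prod.smul_fst, smul_eq_mul]
      field_simp
      unfold dt; ring
    · simp only [Prod.snd_add, Prod.smul_snd, smul_eq_mul]
      field_simp
      unfold dt; ring
  have o1 : ∀ i j l, i < j → j < l → l ≤ i + 7 →
      0 < dt (v i) (v j) + dt (v j) (v l) + dt (v l) (v i) := by
    intro i j l h1 h2 h3
    have d1 := hD i j h1 (by omega)
    have d2 := hD j l h2 (by omega)
    rcases eq_or_lt_of_le h3 with h | h
    · subst h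
      rw [hv7, dt_neg, dt_anti (v i) (v j)]
      have : dt (-v i) (v i) = 0 := by unfold dt; simp only [Prod.fst_neg, Prod.snd_neg]; ring
      rw [this]
      linarith
    · have d3 := hD i l (by omega) h
      rw [dt_anti (v i) (v l)]
      by_contra hc
      have hq := hcoord (v i) (v l) (v j) d3.ne'
      set α := dt (v j) (v l) / dt (v i) (v l) with hα
      set β := dt (v i) (v j) / dt (v i) (v l) with hβ
      have pα : 0 < α := div_pos d2 d3
      have pβ : 0 < β := div_pos d1 d3
      have hsum : α + β ≤ 1 := by
        rw [hα, hβ, ← add_div, div_le_one d3]; linarith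
      have hα1 : 0 < 1 - α := by linarith
      have hm : (0 : ℝ) • v l + (β / (1 - α)) • v l ∈ P :=
        comb_mem hconv h0P (hE _ (hvE l)) (hE _ (hvE l)) le_rfl (by positivity)
          (by rw [zero_add, div_le_one hα1]; linarith)
      have := hN (v j) (hvE j) (v i) (hE _ (hvE i)) _ hm α (1 - α) pα hα1 (by ring) (by
        rw [zero_smul, zero_add, smul_smul, mul_div_cancel₀ _ hα1.ne']
        exact hq.symm)
      rw [this, hself] at d1
      exact lt_irrefl _ d1
  have o2 : ∀ i j l, i < j → j < l → l < i + 14 →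
      0 < dt (v i) (v j) + dt (v j) (v l) + dt (v l) (v i) := by
    intro i j l h1 h2 h3
    by_cases c : l ≤ i + 7
    · exact o1 i j l h1 h2 c
    · by_cases c1 : j < i + 7
      · by_cases c2 : l < j + 7
        · have d1 := hD i j h1 c1
          have d2 := hD j l h2 c2
          have d3 := hD l (i + 14) h3 (by omega)
          rw [hv14] at d3
          linarith
        · have := o1 l (i + 14) (j + 14) (by omega) (by omega) (by omega)
          rw [hv14, hv14] at this
          linarith
      · have := o1 j l (i + 14) (by omega) (by omega) (by omega)
        rw [hv14] at this
        linarith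
  have hedge : ∀ i j, i < j → j < i + 7 → 0 < dt (v (i + 1) - v i) (v (j + 1) - v j) := by
    intro i j h1 h2
    have hmin : ∀ l, i + 1 < l → l < i + 14 →
        dt (v (i + 1) - v i) (v i) < dt (v (i + 1) - v i) (v l) := by
      intro l h1 h2
      have := o2 i (i + 1) l (by omega) h1 h2
      unfold dt at this ⊢
      simp only [Prod.fst_sub, Prod.snd_sub]
      linarith
    have heq : dt (v (i + 1) - v i) (v (i + 1)) = dt (v (i + 1) - v i) (v i) := by
      unfold dt
      simp only [Prod.fst_sub, Prod.snd_sub]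
      ring
    rw [dt_sub]
    by_cases c : j = i + 1
    · subst c
      have := hmin (i + 1 + 1) (by omega) (by omega)
      linarith
    · by_contra hc
      have yD : dt (v (i + 1) - v i) (v j) < dt (v (i + 1) - v i) (v (i + 7)) := by
        have := hmin (j + 7) (by omega) (by omega)
        rw [hv7, dt_neg] at this
        rw [hv7, dt_neg]
        linarith
      have c2 : j + 1 ≠ i + 7 := by
        intro c2
        rw [c2] at hc
        linarith
      have yA := hmin (j + 1) (by omega) (by omega)
      rw [← heq] at yA
      have p1 := o2 j (j + 1) (i + 7) (by omega) (by omega) (by omega)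
      have p2 := o2 (i + 1) j (i + 7) (by omega) (by omega) (by omega)
      have p3 := o2 (i + 1) (j + 1) (i + 7) (by omega) (by omega) (by omega)
      have p4 := o2 (i + 1) j (j + 1) (by omega) (by omega) (by omega)
      generalize v (i + 1) - v i = e at *
      generalize v (i + 1) = A at *
      generalize v j = B at *
      generalize v (j + 1) = C at *
      generalize v (i + 7) = D at *
      have hid : (dt B C + dt C D + dt D B) * dt e A + (dt A B + dt B D + dt D A) * dt e C
          = (dt A C + dt C D + dt D A) * dt e B + (dt A B + dt B C + dt C A) * dt e D := by
        unfold dt; ring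
      have hsum : (dt B C + dt C D + dt D B) + (dt A B + dt B D + dt D A)
          = (dt A C + dt C D + dt D A) + (dt A B + dt B C + dt C A) := by
        unfold dt; ring
      generalize dt B C + dt C D + dt D B = x1 at *
      generalize dt A B + dt B D + dt D A = x2 at *
      generalize dt A C + dt C D + dt D A = x3 at *
      generalize dt A B + dt B C + dt C A = x4 at *
      have q1 := mul_pos p1 (sub_pos.2 yA)
      have q2 : 0 ≤ x3 * (dt e B - dt e C) := mul_nonneg p3.le (by linarith)
      have q3 : 0 ≤ x4 * (dt e D - dt e C) := mul_nonneg p4.le (by linarith)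
      have q4 : (x1 + x2) * dt e C = (x3 + x4) * dt e C := by rw [hsum]
      nlinarith
  refine ⟨v, ⟨hv7, hedge⟩, hvs, ?_⟩
  intro q hq
  obtain ⟨j, h1, h2⟩ : ∃ j, 0 ≤ dt (v j) q ∧ dt (v (j + 1)) q ≤ 0 := by
    by_contra hc
    push Not at hc
    have hs7 : ∀ j, dt (v (j + 7)) q = - dt (v j) q := by
      intro j; rw [hv7]; unfold dt; simp only [Prod.fst_neg, Prod.snd_neg]; ring
    obtain ⟨j0, hj0⟩ : ∃ j0, 0 ≤ dt (v j0) q := by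
      by_contra h
      push Not at h
      have h1 := h 0
      have h2 := h (0 + 7)
      rw [hs7] at h2
      linarith
    have a1 := hc _ hj0
    have a2 := hc _ a1.le
    have a3 := hc _ a2.le
    have a4 := hc _ a3.le
    have a5 := hc _ a4.le
    have a6 := hc _ a5.le
    have a7 := hc _ a6.le
    rw [show j0 + 1 + 1 + 1 + 1 + 1 + 1 + 1 = j0 + 7 by ring, hs7] at a7
    linarith
  have hΔ := hD j (j + 1) (by omega) (by omega)
  rw [hcoord (v j) (v (j + 1)) q hΔ.ne']
  have h3 : 0 ≤ dt q (v (j + 1)) := by rw [dt_anti]; linarith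
  refine comb_mem hconv h0P (hE _ (hvE _)) (hE _ (hvE _)) (by positivity) (by positivity) ?_
  rw [← add_div, div_le_one hΔ]
  have := hq j
  unfold yy dt at this
  unfold dt
  simp only [Prod.fst_sub, Prod.snd_sub] at this
  linarith

theorem isOpen_inO {v : ℤ → Pt} (hv : Gon v) : IsOpen {q | inO v q} := by
  have : {q | inO v q} = ⋂ s ∈ Finset.Ico (0 : ℤ) 14, {q | yy v s (v s) < yy v s q} := by
    ext q
    simp only [mem_iInter, mem_ofPred_eq]
    constructor
    · intro h s _; exact h s
    · intro h s
      obtain ⟨n, r, rfl, h4, h5⟩ := mod14 0 s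
      rw [hv.y14, hv.y14, hv.v14]
      exact h r (Finset.mem_Ico.2 ⟨h4, by simpa using h5⟩)
  rw [this]
  apply isOpen_biInter_finset
  intro s _
  apply isOpen_lt continuous_const
  unfold yy dt
  fun_prop

/-- a centrally symmetric convex tetradecagon admits no `k`-fold translative tiling
of the plane for any positive `k ≤ 6`; that is, `τ(P) ≥ 7`. -/
theorem tetradecagon_translative_ge_seven (P : Set Pt) (hP : IsConvexPolygon P 14)
    (hsym : CentrallySymmetric P) :
    ∀ (I : Type) (x : I → Pt) (k : ℕ), 0 < k → k ≤ 6 →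
      ¬IsKFoldTranslativeTiling P x k := by
  classical
  rintro I x k hk0 hk ⟨hdisc, hcov, hpack⟩
  obtain ⟨hconv, hcomp, -, hfin, hcard, hhull⟩ := hP
  obtain ⟨c, hc⟩ := hsym
  let E : Finset Pt := hfin.toFinset.image (fun p => p - c)
  have hEm : ∀ p, p ∈ E ↔ c + p ∈ extremePoints ℝ P := by
    intro p
    simp only [E, Finset.mem_image, Set.Finite.mem_toFinset]
    constructor
    · rintro ⟨q, hq, rfl⟩; rwa [add_sub_cancel]
    · intro h; exact ⟨c + p, h, by abel⟩
  have hext : ∀ p, p ∈ extremePoints ℝ P → c + c - p ∈ extremePoints ℝ P := by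
    intro p hp
    rw [mem_extremePoints] at hp ⊢
    refine ⟨(hc p).1 hp.1, ?_⟩
    intro x1 h1 x2 h2 hx
    have key := hp.2 (c + c - x1) ((hc x1).1 h1) (c + c - x2) ((hc x2).1 h2) (by
      obtain ⟨a, b, ha, hb, hab, h⟩ := hx
      refine ⟨a, b, ha, hb, hab, ?_⟩
      have e : p = c + c - (a • x1 + b • x2) := by rw [h]; abel
      rw [e]
      have : c + c = (a + b) • (c + c) := by rw [hab, one_smul]
      rw [smul_sub, smul_sub]
      nth_rewrite 3 [this]
      rw [add_smul]; abel)
    constructor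
    · rw [← key.1]; abel
    · rw [← key.2]; abel
  let P0 : Set Pt := {p | c + p ∈ P}
  have hconv0 : Convex ℝ P0 := by
    intro p hp q hq a b ha hb hab
    have := hconv hp hq ha hb hab
    show c + (a • p + b • q) ∈ P
    convert this using 1
    have : c = (a + b) • c := by rw [hab, one_smul]
    nth_rewrite 1 [this]
    rw [smul_add, smul_add, add_smul]; abel
  obtain ⟨v, hv, hvE, hvC⟩ := geom E P0 hconv0
    (by
      rw [Finset.card_image_of_injective _ sub_left_injective, ← hcard, Set.ncard_eq_toFinset_card _ hfin])
    (fun p hp => ((hEm p).1 hp).1)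
    (by
      intro p hp
      rw [hEm] at hp ⊢
      have := hext _ hp
      convert this using 1
      abel)
    (by
      intro p hp p1 h1 p2 h2 a b ha hb hab h
      have hp' := (hEm p).1 hp
      rw [mem_extremePoints] at hp'
      have := (hp'.2 (c + p1) h1 (c + p2) h2 ⟨a, b, ha, hb, hab, by
        rw [← h]
        have : c = (a + b) • c := by rw [hab, one_smul]
        nth_rewrite 3 [this]
        rw [smul_add, smul_add, add_smul]; abel⟩).1
      exact add_left_cancel this)
  have hPC : ∀ q, c + q ∈ P ↔ inC v q := by
    intro q
    refine ⟨?_, hvC q⟩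
    intro hq s
    have hsub : P ⊆ {p | yy v s (v s) ≤ yy v s (p - c)} := by
      rw [hhull]
      apply convexHull_min
      · intro p hp
        obtain ⟨n, hn⟩ := hvE (p - c) ((hEm _).2 (by rwa [add_sub_cancel]))
        show yy v s (v s) ≤ yy v s (p - c)
        rw [hn]; exact hv.min s n
      · intro p hp q hq a b ha hb hab
        have hp : yy v s (v s) ≤ yy v s (p - c) := hp
        have hq : yy v s (v s) ≤ yy v s (q - c) := hq
        show yy v s (v s) ≤ yy v s (a • p + b • q - c)
        have e : yy v s (a • p + b • q - c) = a * yy v s (p - c) + b * yy v s (q - c) := by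
          unfold yy
          rw [dt_sub, dt_sub, dt_sub, dt_add, dt_smul, dt_smul]
          linear_combination (-(dt (v (s + 1) - v s) c)) * (1 - hab)
        rw [e]
        have : yy v s (v s) = a * yy v s (v s) + b * yy v s (v s) := by rw [← add_mul, hab, one_mul]
        rw [this]
        gcongr
    have := hsub hq
    simpa using this
  have hOI : ∀ q, inO v q → c + q ∈ interior P := by
    intro q hq
    have hopen : IsOpen ((fun p : Pt => p - c) ⁻¹' {q | inO v q}) :=
      (isOpen_inO hv).preimage (by fun_prop)
    have hsub : ((fun p : Pt => p - c) ⁻¹' {q | inO v q}) ⊆ P := by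
      intro p hp
      have : inO v (p - c) := hp
      have := (hPC (p - c)).2 (inO_C this)
      rwa [add_sub_cancel] at this
    apply interior_maximal hsub hopen
    show inO v (c + q - c)
    rwa [add_sub_cancel_left]
  obtain ⟨B, hB⟩ := hcomp.isBounded.exists_norm_le
  have ht : Til v (fun i => x i + c) k (B + ‖c‖) := by
    refine ⟨?_, ?_, ?_, ?_⟩
    · intro R
      refine (hdisc (Metric.closedBall 0 (R + ‖c‖)) Metric.isBounded_closedBall).subset ?_
      intro i hi
      have hi : ‖x i + c‖ ≤ R := hi
      show x i ∈ Metric.closedBall 0 (R + ‖c‖)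
      rw [mem_closedBall_zero_iff]
      have : x i = (x i + c) - c := by abel
      rw [this]
      exact (norm_sub_le _ _).trans (by linarith)
    · intro q hq
      have h1 := hB _ ((hPC q).2 hq)
      have : q = (c + q) - c := by abel
      rw [this]
      exact (norm_sub_le _ _).trans (by linarith)
    · intro p
      refine (hcov p).trans (encard_le_encard ?_)
      intro i hi
      have hi : p - x i ∈ P := hi
      show inC v (p - (x i + c))
      rw [← hPC]
      convert hi using 1
      abel
    · intro p
      refine le_trans (encard_le_encard ?_) (hpack p)
      intro i hi
      have := hOI _ hi
      show p - x i ∈ interior P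
      convert this using 1
      abel
  have h0 : inO v 0 := by
    intro s
    have := hv.mneg s
    have e : yy v s 0 = 0 := by simp [yy, dt]
    rw [e]; exact this
  obtain ⟨δ, hδ, hb⟩ := Metric.nhds_basis_closedBall.mem_iff.1 ((isOpen_inO hv).mem_nhds h0)
  exact ht.false hv hk0 hk hδ (fun q hq => hb (mem_closedBall_zero_iff.2 hq))
end
end
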